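/- arXiv:2505.07579 — 2 statements merged into one kernel-verified Lean document; each statement's English description precedes it below -/
import Mathlib

section
/- Consider the rental game with i.i.d. valuations drawn from a distribution D and reward function g (with g(0,0) = 0, nondecreasing in the valuation, and linear in the payment for each fixed valuation), with the associated over-time cost functions. Suppose that for every horizon h ≤ n there exists an optimal (h, D, g, c^{D}_{h,g})-SWAC in which the allocation of every agent lies in {1, h}. Then for all 1 ≤ m < n, R_n/n ≥ R_m/m, where R_h denotes the expected reward of an optimal h-day rental game. -/
open MeasureTheory Filter

namespace RentalGame

/-- The *filter* of a payment schedule: the highest cumulative average payment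
over all prefixes (`0` for the empty schedule). -/
noncomputable def filt (l : List ℝ) : ℝ :=
  ((List.range l.length).map (fun k => (l.take (k + 1)).sum / ((k : ℝ) + 1))).foldr max 0

/-- Utility of an agent with valuation `v` facing payment schedule `l`:
allocation times valuation minus total payment. -/
noncomputable def util (l : List ℝ) (v : ℝ) : ℝ := (l.length : ℝ) * v - l.sum

/-- Gross seller reward `Σ_i g(v, p_i)` from schedule `l` and valuation `v`. -/
noncomputable def gross (g : ℝ → ℝ → ℝ) (v : ℝ) (l : List ℝ) : ℝ := (l.map (g v)).sum

/-- A stagewise auction with seller cost (SWAC) with `n` units and valuation set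
`V ⊆ [0,∞)`.  It consists of a bidding set `B`, a payment schedule for every bid,
and the bid chosen by each agent valuation, which is required to be stagewise-IR
(its filter does not exceed the valuation) and utility-maximizing among all
allowed bids. -/
structure SWAC (n : ℕ) (V : Set ℝ) where
  B : Set ℝ
  sched : ℝ → List ℝ
  bid : ℝ → ℝ
  len_le : ∀ b ∈ B, (sched b).length ≤ n
  pay_nonneg : ∀ b ∈ B, ∀ p ∈ sched b, 0 ≤ p
  bid_mem : ∀ v ∈ V, bid v ∈ B
  bid_IR : ∀ v ∈ V, filt (sched (bid v)) ≤ v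
  bid_opt : ∀ v ∈ V, ∀ b ∈ B, filt (sched b) ≤ v →
    util (sched b) v ≤ util (sched (bid v)) v

namespace SWAC

variable {n : ℕ} {V : Set ℝ}

/-- Allocation of a bid. -/
def X (A : SWAC n V) (b : ℝ) : ℕ := (A.sched b).length

/-- Total payment of a bid. -/
noncomputable def P (A : SWAC n V) (b : ℝ) : ℝ := (A.sched b).sum

/-- Filter of a bid. -/
noncomputable def F (A : SWAC n V) (b : ℝ) : ℝ := filt (A.sched b)

/-- Utility of valuation `v` from bid `b`. -/
noncomputable def u (A : SWAC n V) (v b : ℝ) : ℝ := util (A.sched b) v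

/-- Net seller reward from valuation `v` bidding `b`, w.r.t. reward `g` and cost `c`. -/
noncomputable def r (A : SWAC n V) (g : ℝ → ℝ → ℝ) (c : ℕ → ℝ) (v b : ℝ) : ℝ :=
  gross g v (A.sched b) - c (A.X b)

/-- Net seller reward from valuation `v` under its chosen (optimal) bid. -/
noncomputable def R (A : SWAC n V) (g : ℝ → ℝ → ℝ) (c : ℕ → ℝ) (v : ℝ) : ℝ :=
  A.r g c v (A.bid v)

/-- Allocation of valuation `v` under its chosen bid. -/
def XA (A : SWAC n V) (v : ℝ) : ℕ := A.X (A.bid v)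

/-- Total payment of valuation `v` under its chosen bid. -/
noncomputable def PA (A : SWAC n V) (v : ℝ) : ℝ := A.P (A.bid v)

end SWAC

/-- Ties in the agent's utility are broken in favor of the seller,
w.r.t. reward `g` and cost `c`. -/
def TieFavor {n : ℕ} {V : Set ℝ} (g : ℝ → ℝ → ℝ) (c : ℕ → ℝ) (A : SWAC n V) : Prop :=
  ∀ v ∈ V, ∀ b ∈ A.B, filt (A.sched b) ≤ v →
    util (A.sched b) v = util (A.sched (A.bid v)) v →
    A.r g c v b ≤ A.r g c v (A.bid v)

/-- Expected seller reward `E[A] = 𝔼_{v ∼ D}[R_A(v)]`. -/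
noncomputable def ER {n : ℕ} {V : Set ℝ} (D : Measure ℝ) (g : ℝ → ℝ → ℝ) (c : ℕ → ℝ)
    (A : SWAC n V) : ℝ :=
  ∫ v, A.R g c v ∂D

/-- A SWAC is truthful if the bidding set is `V` and every agent bids its valuation. -/
def Truthful {n : ℕ} {V : Set ℝ} (A : SWAC n V) : Prop :=
  A.B = V ∧ ∀ v ∈ V, A.bid v = v

/-- A SWAC is optimal for the setting `(n, D, g, c)` if it maximizes the expected
reward among all SWACs for this setting. -/
def Optimal {n : ℕ} {V : Set ℝ} (D : Measure ℝ) (g : ℝ → ℝ → ℝ) (c : ℕ → ℝ)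
    (A : SWAC n V) : Prop :=
  TieFavor g c A ∧ ∀ A' : SWAC n V, TieFavor g c A' → ER D g c A' ≤ ER D g c A

/-- A SWAC is fixed-rate if every bid is charged the same payment on every day. -/
def FixedRate {n : ℕ} {V : Set ℝ} (A : SWAC n V) : Prop :=
  ∀ b ∈ A.B, ∃ p : ℝ, A.sched b = List.replicate (A.sched b).length p

/-- Strong allocation monotonicity. -/
def StronglyAllocMono {n : ℕ} {V : Set ℝ} (A : SWAC n V) : Prop :=
  ∀ w ∈ V, ∀ v ∈ V, w < v → A.XA w ≤ A.XA v

/-- Allocation monotonicity, up to a `D`-null set of valuations. -/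
def AllocMono {n : ℕ} {V : Set ℝ} (D : Measure ℝ) (A : SWAC n V) : Prop :=
  ∃ S : Set ℝ, D S = 0 ∧ ∀ w ∈ V \ S, ∀ v ∈ V \ S, w < v → A.XA w ≤ A.XA v

/-- Weak allocation monotonicity: up to a `D`-null set, allocation is monotone on
pairs with distinct seller rewards. -/
def WeaklyAllocMono {n : ℕ} {V : Set ℝ} (D : Measure ℝ) (g : ℝ → ℝ → ℝ) (c : ℕ → ℝ)
    (A : SWAC n V) : Prop :=
  ∃ S : Set ℝ, D S = 0 ∧ ∀ w ∈ V \ S, ∀ v ∈ V \ S, w < v →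
    A.R g c w ≠ A.R g c v → A.XA w ≤ A.XA v

/-- Reward monotonicity, up to a `D`-null set of valuations. -/
def RewardMono {n : ℕ} {V : Set ℝ} (D : Measure ℝ) (g : ℝ → ℝ → ℝ) (c : ℕ → ℝ)
    (A : SWAC n V) : Prop :=
  ∃ S : Set ℝ, D S = 0 ∧ ∀ w ∈ V \ S, ∀ v ∈ V \ S, w < v → A.R g c w ≤ A.R g c v

/-- A rental mechanism: for every horizon `h` and history of past bids, a SWAC with
`h` units that negotiates with the arriving agent, together with a designer-chosen
cost function for that SWAC (which governs the agent's tie-breaking in favor of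
the seller). -/
structure Mech (V : Set ℝ) (g : ℝ → ℝ → ℝ) where
  au : (h : ℕ) → List ℝ → SWAC h V
  mc : (h : ℕ) → List ℝ → ℕ → ℝ
  tie : ∀ (h : ℕ) (hist : List ℝ), TieFavor g (mc h hist) (au h hist)

/-- Expected total reward of a rental mechanism from a given horizon and history:
the arriving agent (drawn from `D h`) bids in the current SWAC, the designer
collects the gross reward `Σ_i g(v, p_i)` over the rented days, and the game
continues at horizon `h − max(x, 1)` once the asset is available again. -/
noncomputable def mechER (V : Set ℝ) (g : ℝ → ℝ → ℝ) (D : ℕ → Measure ℝ) (M : Mech V g) :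
    ℕ → List ℝ → ℝ
  | 0, _ => 0
  | h + 1, hist =>
    ∫ v,
      (gross g v ((M.au (h + 1) hist).sched ((M.au (h + 1) hist).bid v)) +
        mechER V g D M ((h + 1) - max ((M.au (h + 1) hist).XA v) 1)
          (hist ++ [(M.au (h + 1) hist).bid v])) ∂(D (h + 1))
  termination_by h _ => h
  decreasing_by
    exact Nat.sub_lt (Nat.succ_pos _) (lt_of_lt_of_le Nat.one_pos (le_max_right _ _))

/-- `R^{D⃗,g}_h`: the expected reward of an optimal rental mechanism for the last
`h` horizons. -/
noncomputable def optRental (V : Set ℝ) (g : ℝ → ℝ → ℝ) (D : ℕ → Measure ℝ) (h : ℕ) : ℝ :=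
  sSup {x : ℝ | ∃ M : Mech V g, x = mechER V g D M h []}

/-- The over-time cost function
`c^{D⃗}_{h,g}(x) = R^{D⃗,g}_{h−1} − R^{D⃗,g}_{h−max{x,1}}`. -/
noncomputable def overTimeCost (V : Set ℝ) (g : ℝ → ℝ → ℝ) (D : ℕ → Measure ℝ)
    (h : ℕ) (x : ℕ) : ℝ :=
  optRental V g D (h - 1) - optRental V g D (h - max x 1)

section Helpers

lemma foldr_max_le (L : List ℝ) (t : ℝ) : L.foldr max 0 ≤ t ↔ 0 ≤ t ∧ ∀ x ∈ L, x ≤ t := by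
  induction L with
  | nil => simp
  | cons x L ih =>
    simp only [List.foldr_cons, max_le_iff, ih, List.mem_cons, forall_eq_or_imp]
    tauto

lemma filt_le_iff (l : List ℝ) (t : ℝ) : filt l ≤ t ↔
    0 ≤ t ∧ ∀ k < l.length, (l.take (k + 1)).sum / ((k : ℝ) + 1) ≤ t := by
  unfold filt
  rw [foldr_max_le]
  simp

lemma filt_nonneg (l : List ℝ) : 0 ≤ filt l := ((filt_le_iff l _).1 le_rfl).1

lemma prefix_le_filt (l : List ℝ) (k : ℕ) (hk : k < l.length) :
    (l.take (k + 1)).sum / ((k : ℝ) + 1) ≤ filt l := ((filt_le_iff l _).1 le_rfl).2 k hk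

lemma filt_nil : filt [] = 0 := by simp [filt]

lemma sum_le_filt (l : List ℝ) : l.sum ≤ l.length * filt l := by
  rcases Nat.eq_zero_or_pos l.length with h | h
  · rw [List.length_eq_zero_iff] at h; subst h; simp
  · have := prefix_le_filt l (l.length - 1) (by omega)
    have e : l.length - 1 + 1 = l.length := by omega
    rw [e, List.take_length] at this
    have e2 : ((l.length - 1 : ℕ) : ℝ) + 1 = l.length := by exact_mod_cast e
    rw [e2, div_le_iff₀ (by exact_mod_cast h)] at this
    linarith

lemma filt_le_sum (l : List ℝ) (hl : ∀ p ∈ l, 0 ≤ p) : filt l ≤ l.sum := by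
  rw [filt_le_iff]
  refine ⟨List.sum_nonneg hl, fun k hk => ?_⟩
  have h1 : (l.take (k+1)).sum ≤ l.sum := by
    have := List.sum_take_add_sum_drop l (k+1)
    have h2 : 0 ≤ (l.drop (k+1)).sum := List.sum_nonneg fun p hp => hl p (List.mem_of_mem_drop hp)
    linarith
  have h0 : 0 ≤ (l.take (k+1)).sum := List.sum_nonneg fun p hp => hl p (List.mem_of_mem_take hp)
  exact (div_le_self h0 (by linarith [Nat.cast_nonneg (α := ℝ) k])).trans h1

lemma filt_single (p : ℝ) (hp : 0 ≤ p) : filt [p] = p := by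
  simp [filt, hp]

lemma exists_tent (y : ℕ) (t q : ℝ) (h0 : 0 ≤ t) (h1 : t ≤ q) (h2 : q ≤ y * t) :
    ∃ l : List ℝ, l.length = y ∧ (∀ p ∈ l, 0 ≤ p) ∧ l.sum = q ∧ filt l = t := by
  rcases y with _ | y
  · have : q = 0 := by simp at h2; linarith
    exact ⟨[], rfl, by simp, by simp [this], by rw [filt_nil]; linarith⟩
  · set s : ℝ := (q - t) / y with hs
    have hs0 : 0 ≤ s := div_nonneg (by linarith) (Nat.cast_nonneg _)
    have hst : s ≤ t := by
      rcases Nat.eq_zero_or_pos y with h | h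
      · subst h; simp [hs, h0]
      · rw [hs, div_le_iff₀ (by exact_mod_cast h)]; push_cast at h2; linarith
    have hys : (y : ℝ) * s = q - t := by
      rcases Nat.eq_zero_or_pos y with h | h
      · subst h; simp at h2 ⊢; linarith
      · rw [hs]; field_simp
    refine ⟨t :: List.replicate y s, by simp, ?_, ?_, ?_⟩
    · intro p hp
      simp only [List.mem_cons, List.mem_replicate] at hp
      rcases hp with rfl | ⟨_, rfl⟩ <;> assumption
    · simp [hys]
    · apply le_antisymm
      · rw [filt_le_iff]
        refine ⟨h0, fun k hk => ?_⟩
        simp only [List.length_cons, List.length_replicate] at hk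
        rw [div_le_iff₀ (by positivity)]
        simp only [List.take_succ_cons, List.take_replicate, List.sum_cons, List.sum_replicate,
          nsmul_eq_mul]
        rw [min_eq_left (by omega)]
        nlinarith [Nat.cast_nonneg (α := ℝ) k]
      · have := prefix_le_filt (t :: List.replicate y s) 0 (by simp)
        simpa using this

/-- Linear form of the gross reward. -/
lemma gross_eq {g : ℝ → ℝ → ℝ} {v a β : ℝ} (h : ∀ p, g v p = a + β * p) (l : List ℝ) :
    gross g v l = l.length * a + β * l.sum := by
  unfold gross
  induction l with
  | nil => simp
  | cons p l ih => simp [ih, h p]; ring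

variable {V : Set ℝ} {g : ℝ → ℝ → ℝ}

namespace SWAC
variable {n : ℕ}

lemma len_bid (A : SWAC n V) {v : ℝ} (hv : v ∈ V) : (A.sched (A.bid v)).length ≤ n :=
  A.len_le _ (A.bid_mem v hv)

lemma sum_bid_nonneg (A : SWAC n V) {v : ℝ} (hv : v ∈ V) : 0 ≤ (A.sched (A.bid v)).sum :=
  List.sum_nonneg (A.pay_nonneg _ (A.bid_mem v hv))

lemma sum_bid_le (A : SWAC n V) {v : ℝ} (hv : v ∈ V) :
    (A.sched (A.bid v)).sum ≤ (A.sched (A.bid v)).length * v :=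
  (sum_le_filt _).trans (mul_le_mul_of_nonneg_left (A.bid_IR v hv) (Nat.cast_nonneg _))

lemma util_nonneg (A : SWAC n V) {v : ℝ} (hv : v ∈ V) : 0 ≤ util (A.sched (A.bid v)) v := by
  have := A.sum_bid_le hv
  unfold util; linarith

lemma opt_bid (A : SWAC n V) {v w : ℝ} (hv : v ∈ V) (hw : w ∈ V)
    (h : filt (A.sched (A.bid w)) ≤ v) :
    util (A.sched (A.bid w)) v ≤ util (A.sched (A.bid v)) v :=
  A.bid_opt v hv _ (A.bid_mem w hw) h

lemma util_mono (A : SWAC n V) : MonotoneOn (fun v => util (A.sched (A.bid v)) v) V := by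
  intro v hv w hw hvw
  have := A.opt_bid hw hv ((A.bid_IR v hv).trans hvw)
  refine le_trans ?_ this
  unfold util
  have : (A.sched (A.bid v)).length * v ≤ (A.sched (A.bid v)).length * w := by gcongr
  linarith

/-- Payments are uniformly bounded. -/
lemma exists_bound (A : SWAC n V) :
    ∃ K : ℝ, 0 ≤ K ∧ ∀ v ∈ V, (A.sched (A.bid v)).sum ≤ K := by
  have : ∀ y : ℕ, ∃ K : ℝ, ∀ v ∈ V, (A.sched (A.bid v)).length = y →
      (A.sched (A.bid v)).sum ≤ K := by
    intro y
    by_cases h : ∃ v0 ∈ V, (A.sched (A.bid v0)).length = y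
    · obtain ⟨v0, hv0, h0⟩ := h
      refine ⟨y * v0, fun v hv hy => ?_⟩
      rcases le_total v v0 with hle | hle
      · have := A.sum_bid_le hv
        rw [hy] at this
        exact this.trans (by gcongr)
      · have h1 := A.opt_bid hv hv0 ((A.bid_IR v0 hv0).trans hle)
        have h2 := A.sum_bid_le hv0
        unfold util at h1
        rw [h0] at h1 h2
        rw [hy] at h1
        linarith
    · push Not at h
      exact ⟨0, fun v hv hy => absurd hy (h v hv)⟩
  choose K hK using this
  refine ⟨∑ y ∈ Finset.range (n+1), |K y|, Finset.sum_nonneg fun _ _ => abs_nonneg _,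
    fun v hv => ?_⟩
  refine (hK _ v hv rfl).trans ((le_abs_self _).trans ?_)
  exact Finset.single_le_sum (f := fun y => |K y|) (fun _ _ => abs_nonneg _)
    (Finset.mem_range.2 (Nat.lt_succ_of_le (A.len_bid hv)))

/-- Direct (truthful) SWAC. -/
def direct (V : Set ℝ) (n : ℕ) (s : ℝ → List ℝ) (h1 : ∀ v ∈ V, (s v).length ≤ n)
    (h2 : ∀ v ∈ V, ∀ p ∈ s v, 0 ≤ p) (h3 : ∀ v ∈ V, filt (s v) ≤ v)
    (h4 : ∀ v ∈ V, ∀ w ∈ V, filt (s w) ≤ v → util (s w) v ≤ util (s v) v) : SWAC n V where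
  B := V
  sched := s
  bid := id
  len_le := h1
  pay_nonneg := h2
  bid_mem := fun _ h => h
  bid_IR := h3
  bid_opt := h4

/-- SWAC with a constant schedule. -/
def const (V : Set ℝ) (n : ℕ) (l : List ℝ) (h1 : l.length ≤ n)
    (h2 : ∀ p ∈ l, 0 ≤ p) (h3 : ∀ v ∈ V, filt l ≤ v) : SWAC n V :=
  direct V n (fun _ => l) (fun _ _ => h1) (fun _ _ => h2) h3 (fun _ _ _ _ _ => le_rfl)

lemma const_tie (V : Set ℝ) (n : ℕ) (l : List ℝ) (h1 : l.length ≤ n)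
    (h2 : ∀ p ∈ l, 0 ≤ p) (h3 : ∀ v ∈ V, filt l ≤ v) (c : ℕ → ℝ) :
    TieFavor g c (const V n l h1 h2 h3) := fun _ _ _ _ _ _ => le_rfl

end SWAC

/-- The SWAC that never sells. -/
def nullSWAC (V : Set ℝ) (hV : ∀ v ∈ V, 0 ≤ v) (n : ℕ) : SWAC n V :=
  SWAC.const V n [] (by simp) (by simp) (by simpa [filt_nil] using hV)

/-- The mechanism that never sells. -/
def nullMech (V : Set ℝ) (hV : ∀ v ∈ V, 0 ≤ v) (g : ℝ → ℝ → ℝ) : Mech V g where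
  au := fun h _ => nullSWAC V hV h
  mc := fun _ _ _ => 0
  tie := fun _ _ => SWAC.const_tie _ _ _ _ _ _ _

lemma mechER_zero (D : ℕ → Measure ℝ) (M : Mech V g) (hist : List ℝ) :
    mechER V g D M 0 hist = 0 := by rw [mechER]

lemma mechER_null (D : ℕ → Measure ℝ) (hV : ∀ v ∈ V, 0 ≤ v) (h : ℕ) (hist : List ℝ) :
    mechER V g D (nullMech V hV g) h hist = 0 := by
  induction h generalizing hist with
  | zero => exact mechER_zero _ _ _
  | succ h ih =>
    rw [mechER]
    have : ∀ v, (((nullMech V hV g).au (h+1) hist).XA v) = 0 := fun _ => rfl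
    simp only [this]
    have : ∀ v, gross g v (((nullMech V hV g).au (h+1) hist).sched
      (((nullMech V hV g).au (h+1) hist).bid v)) = 0 := fun _ => rfl
    simp only [this]
    simp [ih]

lemma mechER_congr (D : ℕ → Measure ℝ) (M M' : Mech V g) (pre pre' : List ℝ)
    (H : ∀ k hist, M'.au k (pre' ++ hist) = M.au k (pre ++ hist)) (k : ℕ) (hist : List ℝ) :
    mechER V g D M' k (pre' ++ hist) = mechER V g D M k (pre ++ hist) := by
  induction k using Nat.strong_induction_on generalizing hist with
  | _ k ih =>
    rcases k with _ | k
    · rw [mechER_zero, mechER_zero]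
    · rw [mechER, mechER]
      simp only [H, List.append_assoc]
      congr 1
      ext v
      rw [ih _ (Nat.sub_lt (Nat.succ_pos _) (lt_of_lt_of_le Nat.one_pos (le_max_right _ _)))]

lemma exists_shift (D : ℕ → Measure ℝ) (M : Mech V g) (k : ℕ) (hist : List ℝ) :
    ∃ M' : Mech V g, mechER V g D M' k [] = mechER V g D M k hist := by
  refine ⟨⟨fun h l => M.au h (hist ++ l), fun h l => M.mc h (hist ++ l),
    fun h l => M.tie h (hist ++ l)⟩, ?_⟩
  have := mechER_congr D M ⟨fun h l => M.au h (hist ++ l), fun h l => M.mc h (hist ++ l),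
    fun h l => M.tie h (hist ++ l)⟩ hist [] (fun _ _ => rfl) k []
  simpa using this

lemma exists_prepend (D : ℕ → Measure ℝ) (hV : ∀ v ∈ V, 0 ≤ v) (M : Mech V g) (h : ℕ)
    (A : SWAC (h+1) V) (c : ℕ → ℝ) (hA : TieFavor g c A) :
    ∃ M' : Mech V g, mechER V g D M' (h+1) [] =
      ∫ v, (gross g v (A.sched (A.bid v)) + mechER V g D M ((h+1) - max (A.XA v) 1) [])
        ∂(D (h+1)) := by
  classical
  let au : (k : ℕ) → List ℝ → SWAC k V := fun k l => match l with
    | [] => if hk : k = h + 1 then hk ▸ A else nullSWAC V hV k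
    | _ :: t => M.au k t
  let mc : (k : ℕ) → List ℝ → ℕ → ℝ := fun k l => match l with
    | [] => c
    | _ :: t => M.mc k t
  have tie : ∀ k l, TieFavor g (mc k l) (au k l) := by
    intro k l
    cases l with
    | nil =>
      by_cases hk : k = h + 1
      · subst hk; simpa [au, mc] using hA
      · simp only [au, mc, hk, dite_false]
        exact SWAC.const_tie _ _ _ _ _ _ _
    | cons b t => exact M.tie k t
  refine ⟨⟨au, mc, tie⟩, ?_⟩
  rw [mechER]
  have e : au (h+1) [] = A := by simp [au]
  simp only [e]
  congr 1
  ext v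
  congr 1
  have := mechER_congr D M ⟨au, mc, tie⟩ [] [A.bid v] (fun _ _ => rfl)
    ((h+1) - max (A.XA v) 1) []
  simpa using this

lemma optRental_nonneg (D : ℕ → Measure ℝ) (hV : ∀ v ∈ V, 0 ≤ v) (h : ℕ) :
    0 ≤ optRental V g D h := by
  unfold optRental
  by_cases hb : BddAbove {x : ℝ | ∃ M : Mech V g, x = mechER V g D M h []}
  · exact le_csSup hb ⟨nullMech V hV g, (mechER_null D hV h []).symm⟩
  · rw [Real.sSup_of_not_bddAbove hb]

lemma optRental_zero (D : ℕ → Measure ℝ) (hV : ∀ v ∈ V, 0 ≤ v) :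
    optRental V g D 0 = 0 := by
  refine le_antisymm (Real.sSup_le ?_ le_rfl) (optRental_nonneg D hV 0)
  rintro x ⟨M, rfl⟩
  rw [mechER_zero]

lemma mechER_le_optRental (D : ℕ → Measure ℝ) (k : ℕ)
    (hb : BddAbove {x : ℝ | ∃ M : Mech V g, x = mechER V g D M k []})
    (M : Mech V g) (hist : List ℝ) : mechER V g D M k hist ≤ optRental V g D k := by
  obtain ⟨M', h⟩ := exists_shift D M k hist
  rw [← h]
  exact le_csSup hb ⟨M', rfl⟩


lemma ae_mem_of_null {D : Measure ℝ} (hD : D Vᶜ = 0) : ∀ᵐ v ∂D, v ∈ V := by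
  rw [ae_iff]; exact hD

lemma aemeasurable_of_monotoneOn {D : Measure ℝ} (hD : D Vᶜ = 0) {S : Set ℝ}
    (hS : MeasurableSet S) {f : ℝ → ℝ}
    (hf : MonotoneOn f (V ∩ S)) : AEMeasurable f (D.restrict S) := by
  have hV0 : MeasurableSet ((toMeasurable D Vᶜ)ᶜ) := (measurableSet_toMeasurable _ _).compl
  have hsub : (toMeasurable D Vᶜ)ᶜ ⊆ V := by
    rw [Set.compl_subset_comm]; exact subset_toMeasurable _ _
  have hz : D ((toMeasurable D Vᶜ)ᶜ)ᶜ = 0 := by rw [compl_compl, measure_toMeasurable, hD]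
  have : (D.restrict S).restrict ((toMeasurable D Vᶜ)ᶜ) = D.restrict S :=
    Measure.restrict_eq_self_of_ae_mem (ae_mem_of_null
      (le_antisymm ((Measure.restrict_apply_le _ _).trans hz.le) bot_le))
  rw [← this, Measure.restrict_restrict hV0]
  exact aemeasurable_restrict_of_monotoneOn (hV0.inter hS)
    (hf.mono (Set.inter_subset_inter_left _ hsub))

lemma nullMeasurable_V {D : Measure ℝ} (hD : D Vᶜ = 0) : NullMeasurableSet V D := by
  have : NullMeasurableSet Vᶜ D := NullMeasurableSet.of_null hD
  simpa using this.compl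

lemma nullMeasurable_records {D : Measure ℝ} (hD : D Vᶜ = 0) {ψ : ℝ → ℝ}
    (hψ : AEMeasurable ψ D) :
    NullMeasurableSet {v | v ∈ V ∧ ∀ w ∈ V, v ≤ w → ψ w ≤ ψ v} D := by
  let m : ℝ → EReal := fun v => ⨆ w, ⨆ (_ : w ∈ V ∧ v ≤ w), (ψ w : EReal)
  have hm : Antitone m := by
    intro v v' hvv'
    refine iSup_le fun w => iSup_le fun hw => ?_
    exact le_iSup₂_of_le w ⟨hw.1, hvv'.trans hw.2⟩ le_rfl
  have : {v | v ∈ V ∧ ∀ w ∈ V, v ≤ w → ψ w ≤ ψ v} = V ∩ {v | m v ≤ (ψ v : EReal)} := by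
    ext v
    simp only [Set.mem_ofPred_eq, Set.mem_inter_iff, m, iSup_le_iff, EReal.coe_le_coe_iff, and_imp]
  rw [this]
  exact (nullMeasurable_V hD).inter
    (nullMeasurableSet_le hm.measurable.aemeasurable hψ.coe_real_ereal)

lemma nullMeasurable_good {D : Measure ℝ} (hD : D Vᶜ = 0) {ψ : ℝ → ℝ}
    (hψ : AEMeasurable ψ D) :
    NullMeasurableSet
      {v | v ∈ V ∧ 0 ≤ ψ v ∧ ∀ w ∈ V, min v (ψ v) ≤ w → ψ w ≤ ψ v} D := by
  have e : {v | v ∈ V ∧ 0 ≤ ψ v ∧ ∀ w ∈ V, min v (ψ v) ≤ w → ψ w ≤ ψ v} =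
      {v | 0 ≤ ψ v} ∩ (({v | v ≤ ψ v} ∩ {v | v ∈ V ∧ ∀ w ∈ V, v ≤ w → ψ w ≤ ψ v}) ∪
        {v | v ∈ V ∧ ψ v < v ∧ ∀ w ∈ V, ψ v ≤ w → ψ w ≤ ψ v}) := by
    ext v
    simp only [Set.mem_ofPred_eq, Set.mem_inter_iff, Set.mem_union]
    rcases le_or_gt v (ψ v) with h | h
    · rw [min_eq_left h]; have := not_lt.2 h; tauto
    · rw [min_eq_right h.le]; have := not_le.2 h; tauto
  rw [e]
  refine (nullMeasurableSet_le aemeasurable_const hψ).inter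
    (((nullMeasurableSet_le aemeasurable_id hψ).inter (nullMeasurable_records hD hψ)).union ?_)
  rcases Set.eq_empty_or_nonempty {v | v ∈ V ∧ ψ v < v ∧ ∀ w ∈ V, ψ v ≤ w → ψ w ≤ ψ v} with
    h | ⟨v0, hv0, h1, h2⟩
  · rw [h]; exact nullMeasurableSet_empty
  · have : {v | v ∈ V ∧ ψ v < v ∧ ∀ w ∈ V, ψ v ≤ w → ψ w ≤ ψ v} =
        V ∩ ({v | ψ v ≤ ψ v0} ∩ {v | ψ v0 ≤ ψ v} ∩ {v | ψ v0 < v}) := by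
      ext v
      simp only [Set.mem_ofPred_eq, Set.mem_inter_iff]
      constructor
      · rintro ⟨hv, h3, h4⟩
        rcases le_total v v0 with hle | hle
        · have h5 := h4 v0 hv0 (h3.le.trans hle)
          have h6 := h2 v hv (h5.trans h3.le)
          exact ⟨hv, ⟨h6, h5⟩, h5.trans_lt h3⟩
        · have h5 := h2 v hv (h1.le.trans hle)
          have h6 := h4 v0 hv0 (h5.trans h1.le)
          exact ⟨hv, ⟨h5, h6⟩, h1.trans_le hle⟩
      · rintro ⟨hv, ⟨h3, h4⟩, h5⟩
        have e : ψ v = ψ v0 := le_antisymm h3 h4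
        rw [e]
        exact ⟨hv, h5, h2⟩
    rw [this]
    exact (nullMeasurable_V hD).inter (((nullMeasurableSet_le hψ aemeasurable_const).inter
      (nullMeasurableSet_le aemeasurable_const hψ)).inter
      (nullMeasurableSet_lt aemeasurable_const aemeasurable_id))

lemma exists_dominating (hV : ∀ v ∈ V, 0 ≤ v) {D : Measure ℝ} (hD : D Vᶜ = 0) {a : ℝ → ℝ} {β : ℝ}
    (hga : ∀ v ∈ V, ∀ p, g v p = a v + β * p) (ha : AEMeasurable a D)
    {h : ℕ} (A : SWAC h V) (c : ℕ → ℝ) :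
    ∃ A' : SWAC h V, TieFavor g c A' ∧ (∀ v ∈ V, A.R g c v ≤ A'.R g c v) ∧
      AEMeasurable (A'.R g c) D := by
  classical
  set U : ℝ → ℝ := fun v => util (A.sched (A.bid v)) v with hU
  have hUm : AEMeasurable U D := by
    have := aemeasurable_of_monotoneOn hD MeasurableSet.univ
      (f := U) (by simpa using A.util_mono)
    simpa using this
  let Good : ℕ → ℝ → List ℝ → Prop := fun y v l => l.length = y ∧ (∀ p ∈ l, 0 ≤ p) ∧ filt l ≤ v ∧
    util l v = U v ∧ ∀ w ∈ V, filt l ≤ w → util l w ≤ U w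
  let rew : ℕ → ℝ → ℝ := fun y v => y * a v + β * (y * v - U v) - c y
  have hrew : ∀ y v l, v ∈ V → Good y v l → gross g v l - c l.length = rew y v := by
    rintro y v l hv ⟨h1, -, -, h4, -⟩
    rw [gross_eq (hga v hv)]
    unfold util at h4
    rw [h1] at h4 ⊢
    simp only [rew]; rw [← h4]; ring
  have hA0 : ∀ v ∈ V, Good (A.XA v) v (A.sched (A.bid v)) := fun v hv =>
    ⟨rfl, A.pay_nonneg _ (A.bid_mem v hv), A.bid_IR v hv, rfl,
      fun w hw hf => A.opt_bid hw hv hf⟩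
  have hmax : ∀ v, v ∈ V → ∃ l, l.length ≤ h ∧ Good l.length v l ∧
      ∀ z ≤ h, ∀ l', Good z v l' → rew z v ≤ rew l.length v := by
    intro v hv
    let S := (Finset.range (h+1)).filter (fun y => ∃ l, Good y v l)
    have hS : S.Nonempty := ⟨A.XA v, Finset.mem_filter.2
      ⟨Finset.mem_range.2 (Nat.lt_succ_of_le (A.len_bid hv)), _, hA0 v hv⟩⟩
    obtain ⟨y, hy, hyy⟩ := S.exists_max_image (fun y => rew y v) hS
    obtain ⟨hy1, l, hl⟩ := Finset.mem_filter.1 hy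
    have : l.length = y := hl.1
    subst this
    refine ⟨l, Nat.lt_succ_iff.1 (Finset.mem_range.1 hy1), hl, fun z hz l' hl' => ?_⟩
    exact hyy z (Finset.mem_filter.2 ⟨Finset.mem_range.2 (Nat.lt_succ_of_le hz), l', hl'⟩)
  choose! s hs1 hs2 hs3 using hmax
  let A' : SWAC h V := SWAC.direct V h s hs1 (fun v hv => (hs2 v hv).2.1)
    (fun v hv => (hs2 v hv).2.2.1) (fun v hv w hw hf => by
      rw [(hs2 v hv).2.2.2.1]
      exact (hs2 w hw).2.2.2.2 v hv hf)
  have hR : ∀ v ∈ V, A'.R g c v = rew (s v).length v := fun v hv => hrew _ v _ hv (hs2 v hv)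
  refine ⟨A', ?_, ?_, ?_⟩
  · intro v hv w hw hf hu
    change gross g v (s w) - c (s w).length ≤ gross g v (s v) - c (s v).length
    change filt (s w) ≤ v at hf
    change util (s w) v = util (s v) v at hu
    rw [(hs2 v hv).2.2.2.1] at hu
    have hgw : Good (s w).length v (s w) :=
      ⟨rfl, (hs2 w hw).2.1, hf, hu, (hs2 w hw).2.2.2.2⟩
    rw [hrew _ v _ hv hgw, hrew _ v _ hv (hs2 v hv)]
    exact hs3 v hv _ (hs1 w hw) _ hgw
  · intro v hv
    rw [hR v hv]
    have : A.R g c v = rew (A.XA v) v := hrew _ v _ hv (hA0 v hv)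
    rw [this]
    exact hs3 v hv _ (A.len_bid hv) _ (hA0 v hv)
  · have hψ : ∀ y : ℕ, AEMeasurable (fun v => (y : ℝ) * v - U v) D := fun y =>
      (aemeasurable_id.const_mul _).sub hUm
    have hrm : ∀ y, AEMeasurable (rew y) D := fun y =>
      (((ha.const_mul _).add ((hψ y).const_mul _)).sub aemeasurable_const)
    let T : ℕ → Set ℝ := fun y => {v | v ∈ V ∧ ∃ l, Good y v l}
    have hT : ∀ y, NullMeasurableSet (T y) D := by
      intro y
      have := nullMeasurable_good hD (hψ y)
      convert this using 1
      ext v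
      simp only [T, Set.mem_ofPred_eq, and_congr_right_iff]
      intro hv
      constructor
      · rintro ⟨l, h1, h2, h3, h4, h5⟩
        have hsum : l.sum = y * v - U v := by rw [← h4, util, h1]; ring
        rw [← hsum]
        refine ⟨List.sum_nonneg h2, fun w hw hw2 => ?_⟩
        have := h5 w hw ((le_min h3 (filt_le_sum l h2)).trans hw2)
        rw [util, h1] at this
        linarith
      · rintro ⟨h1, h2⟩
        have hU0 : 0 ≤ U v := A.util_nonneg hv
        have h3 : y * v - U v ≤ y * min v (y * v - U v) := by
          rcases le_total v (y * v - U v) with h | h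
          · rw [min_eq_left h]; linarith
          · rw [min_eq_right h]
            rcases Nat.eq_zero_or_pos y with h0 | h0
            · subst h0; simp at h1 ⊢; linarith
            · have : (1:ℝ) ≤ y := by exact_mod_cast h0
              nlinarith
        obtain ⟨l, hl1, hl2, hl3, hl4⟩ := exists_tent y (min v (y * v - U v)) (y * v - U v)
          (le_min (hV v hv) h1) (min_le_right _ _) h3
        refine ⟨l, hl1, hl2, by rw [hl4]; exact min_le_left _ _, by rw [util, hl1, hl3]; ring,
          fun w hw hf => ?_⟩
        rw [hl4] at hf
        have := h2 w hw hf
        rw [util, hl1, hl3]; linarith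
    let C : ℕ → Set ℝ := fun y => T y ∩ ⋂ z ∈ Finset.range (h+1), ((T z)ᶜ ∪ {v | rew z v ≤ rew y v})
    have hC : ∀ y, NullMeasurableSet (C y) D := fun y => (hT y).inter
      (Finset.nullMeasurableSet_biInter _ fun z _ =>
        (hT z).compl.union (nullMeasurableSet_le (hrm z) (hrm y)))
    have hcover : ∀ v ∈ V, v ∈ C (s v).length := by
      intro v hv
      refine ⟨⟨hv, s v, hs2 v hv⟩, ?_⟩
      simp only [Set.mem_iInter, Finset.mem_range]
      intro z hz
      by_cases hzT : v ∈ T z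
      · obtain ⟨-, l, hl⟩ := hzT
        exact Or.inr (hs3 v hv z (Nat.lt_succ_iff.1 hz) l hl)
      · exact Or.inl hzT
    have hD' : D.restrict (⋃ y : Fin (h+1), C y) = D := by
      apply Measure.restrict_eq_self_of_ae_mem
      filter_upwards [ae_mem_of_null hD] with v hv
      exact Set.mem_iUnion.2 ⟨⟨(s v).length, Nat.lt_succ_of_le (hs1 v hv)⟩, hcover v hv⟩
    rw [← hD', aemeasurable_iUnion_iff]
    intro y
    refine AEMeasurable.congr (hrm y).restrict ?_
    rw [Filter.EventuallyEq, ae_restrict_iff'₀ (hC y)]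
    refine Eventually.of_forall fun v hv => ?_
    obtain ⟨⟨hvV, l, hl⟩, hv2⟩ := hv
    simp only [Set.mem_iInter, Finset.mem_range] at hv2
    rw [hR v hvV]
    apply le_antisymm
    · exact hs3 v hvV _ (Nat.lt_succ_iff.1 y.2) l hl
    · rcases hv2 (s v).length (Nat.lt_succ_of_le (hs1 v hvV)) with h5 | h5
      · exact absurd ⟨hvV, s v, hs2 v hvV⟩ h5
      · exact h5


lemma abs_le_sum_abs (c : ℕ → ℝ) {y h : ℕ} (hy : y ≤ h) :
    |c y| ≤ ∑ z ∈ Finset.range (h+1), |c z| :=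
  Finset.single_le_sum (f := fun z => |c z|) (fun _ _ => abs_nonneg _)
    (Finset.mem_range.2 (Nat.lt_succ_of_le hy))

lemma mechER_le {D : Measure ℝ} [IsProbabilityMeasure D] (hV : ∀ v ∈ V, 0 ≤ v)
    (hD : D Vᶜ = 0) {a : ℝ → ℝ} {β : ℝ}
    (hga : ∀ v ∈ V, ∀ p, g v p = a v + β * p) (ha : AEMeasurable a D)
    (hap : Integrable (fun v => max (a v) 0) D) {h : ℕ}
    (hb : ∀ k ≤ h, BddAbove {x : ℝ | ∃ M : Mech V g, x = mechER V g (fun _ => D) M k []})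
    (A : SWAC (h+1) V) (hA : Optimal D g (overTimeCost V g (fun _ => D) (h+1)) A)
    (M : Mech V g) (hist : List ℝ) :
    mechER V g (fun _ => D) M (h+1) hist ≤
      optRental V g (fun _ => D) h + ER D g (overTimeCost V g (fun _ => D) (h+1)) A := by
  set c := overTimeCost V g (fun _ => D) (h+1) with hc
  set Rh := optRental V g (fun _ => D) h with hRh
  have hRh0 : 0 ≤ Rh := optRental_nonneg _ hV _
  have hER0 : 0 ≤ ER D g c A := by
    have := hA.2 (nullSWAC V hV (h+1)) (SWAC.const_tie _ _ _ _ _ _ _)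
    refine le_trans (le_of_eq ?_) this
    have h0 : ∀ v, (nullSWAC V hV (h+1)).R g c v = 0 := by
      intro v
      change (0:ℝ) - c 0 = 0
      simp [hc, overTimeCost]
    simp [ER, h0]
  rw [mechER]
  set A0 := M.au (h+1) hist with hA0
  by_cases hint : Integrable (fun v => gross g v (A0.sched (A0.bid v)) +
        mechER V g (fun _ => D) M ((h + 1) - max (A0.XA v) 1) (hist ++ [A0.bid v])) D
  swap
  · rw [integral_undef hint]; linarith
  obtain ⟨A', ht, hdom, hmeas⟩ := exists_dominating hV hD hga ha A0 c
  have hf : ∀ v ∈ V, gross g v (A0.sched (A0.bid v)) +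
        mechER V g (fun _ => D) M ((h + 1) - max (A0.XA v) 1) (hist ++ [A0.bid v])
        ≤ Rh + A'.R g c v := by
    intro v hv
    have h1 := mechER_le_optRental (fun _ => D) ((h + 1) - max (A0.XA v) 1)
      (hb _ (by have := le_max_right (A0.XA v) 1; omega)) M (hist ++ [A0.bid v])
    have h2 := hdom v hv
    have h3 : A0.R g c v = gross g v (A0.sched (A0.bid v)) - c (A0.XA v) := rfl
    have h4 : c (A0.XA v) = Rh - optRental V g (fun _ => D) (h + 1 - max (A0.XA v) 1) := rfl
    linarith
  obtain ⟨K, hK0, hK⟩ := A'.exists_bound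
  have hup : ∀ v ∈ V, A'.R g c v ≤
      (h+1) * max (a v) 0 + (|β| * K + ∑ z ∈ Finset.range (h+1+1), |c z|) := by
    intro v hv
    have h3 : A'.R g c v = gross g v (A'.sched (A'.bid v)) - c (A'.XA v) := rfl
    rw [h3, gross_eq (hga v hv)]
    have h4 := abs_le_sum_abs c (A'.len_bid hv)
    have h4' : -c (A'.XA v) ≤ |c (A'.sched (A'.bid v)).length| := neg_le_abs _
    have h5 : β * (A'.sched (A'.bid v)).sum ≤ |β| * K := by
      refine (mul_le_mul_of_nonneg_right (le_abs_self β) (A'.sum_bid_nonneg hv)).trans ?_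
      exact mul_le_mul_of_nonneg_left (hK v hv) (abs_nonneg _)
    have h6 : ((A'.sched (A'.bid v)).length : ℝ) ≤ h+1 := by exact_mod_cast A'.len_bid hv
    have h7 : ((A'.sched (A'.bid v)).length : ℝ) * a v ≤ (h+1) * max (a v) 0 := by
      refine (mul_le_mul_of_nonneg_left (le_max_left (a v) 0) (Nat.cast_nonneg _)).trans ?_
      exact mul_le_mul_of_nonneg_right h6 (le_max_right _ _)
    linarith
  have hint' : Integrable (A'.R g c) D := by
    have hi1 := hint.sub (integrable_const Rh)
    have hi2 : Integrable (fun v => ((h:ℝ)+1) * max (a v) 0 +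
      (|β| * K + ∑ z ∈ Finset.range (h+1+1), |c z|)) D :=
      (hap.const_mul _).add (integrable_const _)
    refine Integrable.mono' (hi1.abs.add hi2.abs) hmeas.aestronglyMeasurable ?_
    filter_upwards [ae_mem_of_null hD] with v hv
    have h1 := hf v hv
    have h2 := hup v hv
    simp only [Pi.add_apply, Pi.sub_apply, Real.norm_eq_abs]
    rw [abs_le]
    constructor
    · have := neg_abs_le (gross g v (A0.sched (A0.bid v)) +
        mechER V g (fun _ => D) M ((h + 1) - max (A0.XA v) 1) (hist ++ [A0.bid v]) - Rh)
      have h8 := abs_nonneg (((h:ℝ)+1) * max (a v) 0 +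
      (|β| * K + ∑ z ∈ Finset.range (h+1+1), |c z|))
      linarith
    · have := le_abs_self (((h:ℝ)+1) * max (a v) 0 +
      (|β| * K + ∑ z ∈ Finset.range (h+1+1), |c z|))
      have h8 := abs_nonneg (gross g v (A0.sched (A0.bid v)) +
        mechER V g (fun _ => D) M ((h + 1) - max (A0.XA v) 1) (hist ++ [A0.bid v]) - Rh)
      linarith
  have h1 := hA.2 A' ht
  have h2 := integral_mono_ae hint ((integrable_const Rh).add hint') (by
    filter_upwards [ae_mem_of_null hD] with v hv
    exact hf v hv)
  refine h2.trans ?_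
  have e : ∫ v, (Rh + A'.R g c v) ∂D = Rh + ER D g c A' := by
    rw [integral_add (integrable_const Rh) hint']
    simp [ER]
  have e' := e.le
  simp only [Pi.add_apply]
  linarith

lemma mechER_degenerate {D : Measure ℝ} [IsProbabilityMeasure D]
    (hD : D Vᶜ = 0) {a : ℝ → ℝ} {β : ℝ} (haV : MonotoneOn a V)
    (hga : ∀ v ∈ V, ∀ p, g v p = a v + β * p) (ha : AEMeasurable a D)
    (hap : ¬ Integrable (fun v => max (a v) 0) D)
    (M : Mech V g) (h : ℕ) (hist : List ℝ) :
    mechER V g (fun _ => D) M h hist = 0 := by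
  induction h using Nat.strong_induction_on generalizing hist with
  | _ h ih =>
    rcases h with _ | h
    · exact mechER_zero _ _ _
    rw [mechER]
    set A0 := M.au (h+1) hist with hA0
    have e : (fun v => gross g v (A0.sched (A0.bid v)) +
        mechER V g (fun _ => D) M ((h + 1) - max (A0.XA v) 1) (hist ++ [A0.bid v])) =
        fun v => gross g v (A0.sched (A0.bid v)) := by
      ext v
      rw [ih _ (by have := le_max_right (A0.XA v) 1; omega), add_zero]
    rw [e]
    by_cases hint : Integrable (fun v => gross g v (A0.sched (A0.bid v))) D
    swap
    · exact integral_undef hint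
    by_cases hx : ∃ v0 ∈ V, (A0.sched (A0.bid v0)).length ≠ 0
    · exfalso
      apply hap
      obtain ⟨v0, hv0, hlen⟩ := hx
      obtain ⟨K, hK0, hK⟩ := A0.exists_bound
      refine Integrable.mono' (hint.abs.add (integrable_const (|β| * K + max (a v0) 0)))
        (ha.max aemeasurable_const).aestronglyMeasurable ?_
      filter_upwards [ae_mem_of_null hD] with v hv
      simp only [Pi.add_apply, Real.norm_eq_abs]
      rw [abs_of_nonneg (le_max_right _ _)]
      have hbK : 0 ≤ |β| * K := mul_nonneg (abs_nonneg _) hK0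
      have hm0 : 0 ≤ max (a v0) 0 := le_max_right _ _
      have hg0 := abs_nonneg (gross g v (A0.sched (A0.bid v)))
      rcases le_or_gt v v0 with hle | hlt
      · have : max (a v) 0 ≤ max (a v0) 0 := max_le_max (haV hv hv0 hle) le_rfl
        linarith
      · have h1 := A0.opt_bid hv hv0 ((A0.bid_IR v0 hv0).trans hlt.le)
        have h2 := A0.util_nonneg hv0
        have hpos : 0 < (A0.sched (A0.bid v)).length := by
          by_contra hcon
          have hz : A0.sched (A0.bid v) = [] := by
            rw [← List.length_eq_zero_iff]; omega
          rw [hz] at h1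
          unfold util at h1 h2
          simp only [List.length_nil, List.sum_nil] at h1
          have : (0:ℝ) < (A0.sched (A0.bid v0)).length := by
            exact_mod_cast Nat.pos_of_ne_zero hlen
          push_cast at h1
          nlinarith
        have hpos' : (1:ℝ) ≤ (A0.sched (A0.bid v)).length := by exact_mod_cast hpos
        rcases le_total (a v) 0 with h0 | h0
        · rw [max_eq_right h0]; linarith
        · rw [max_eq_left h0]
          have h3 := le_abs_self (gross g v (A0.sched (A0.bid v)))
          rw [gross_eq (hga v hv)] at h3 ⊢
          have h5 : -(β * (A0.sched (A0.bid v)).sum) ≤ |β| * K := by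
            have := mul_le_mul_of_nonneg_right (neg_abs_le β) (A0.sum_bid_nonneg hv)
            have := mul_le_mul_of_nonneg_left (hK v hv) (abs_nonneg β)
            linarith
          nlinarith
    · push Not at hx
      have : (fun v => gross g v (A0.sched (A0.bid v))) =ᵐ[D] fun _ => 0 := by
        filter_upwards [ae_mem_of_null hD] with v hv
        have := hx v hv
        rw [List.length_eq_zero_iff] at this
        rw [this]; rfl
      rw [integral_congr_ae this]; simp

lemma ER_eq_zero {D : Measure ℝ} [IsProbabilityMeasure D]
    (hD : D Vᶜ = 0) {a : ℝ → ℝ} {β : ℝ}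
    (hga : ∀ v ∈ V, ∀ p, g v p = a v + β * p) (ha : AEMeasurable a D)
    (hap : ¬ Integrable a D) {h : ℕ} (A : SWAC h V) (c : ℕ → ℝ)
    (hA : ∀ v ∈ V, 1 ≤ A.XA v) : ER D g c A = 0 := by
  refine integral_undef fun hint => hap ?_
  obtain ⟨K, hK0, hK⟩ := A.exists_bound
  refine Integrable.mono' (hint.abs.add (integrable_const
    (|β| * K + ∑ z ∈ Finset.range (h+1), |c z|))) ha.aestronglyMeasurable ?_
  filter_upwards [ae_mem_of_null hD] with v hv
  simp only [Pi.add_apply, Real.norm_eq_abs]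
  have h3 : A.R g c v = gross g v (A.sched (A.bid v)) - c (A.sched (A.bid v)).length := rfl
  rw [gross_eq (hga v hv)] at h3
  have h4 := abs_le_sum_abs c (A.len_bid hv)
  have h5 : |β * (A.sched (A.bid v)).sum| ≤ |β| * K := by
    rw [abs_mul, abs_of_nonneg (A.sum_bid_nonneg hv)]
    exact mul_le_mul_of_nonneg_left (hK v hv) (abs_nonneg _)
  have h6 : (1:ℝ) ≤ (A.sched (A.bid v)).length := by exact_mod_cast hA v hv
  have h7 : (A.sched (A.bid v)).length * a v = A.R g c v - β * (A.sched (A.bid v)).sum +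
    c (A.sched (A.bid v)).length := by rw [h3]; ring
  have h8 : |a v| ≤ |(A.sched (A.bid v)).length * a v| := by
    rw [abs_mul, Nat.abs_cast]
    nlinarith [abs_nonneg (a v)]
  rw [h7] at h8
  have h9 := abs_add_le (A.R g c v - β * (A.sched (A.bid v)).sum) (c (A.sched (A.bid v)).length)
  have h10 := abs_sub (A.R g c v) (β * (A.sched (A.bid v)).sum)
  linarith


/-- Structure of a SWAC whose allocations lie in `{1, h}`. -/
lemma exists_structure {h : ℕ} (hh : 1 ≤ h) (A : SWAC h V)
    (hX : ∀ v ∈ V, A.XA v = 1 ∨ A.XA v = h) :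
    ∃ (L : Set ℝ) (p₁ : ℝ), L ⊆ V ∧ (∀ v ∈ L, A.sched (A.bid v) = [p₁]) ∧
      (∀ v ∈ V, v ∉ L → (A.sched (A.bid v)).length = h) ∧
      (L.Nonempty → 2 ≤ h ∧ 0 ≤ p₁ ∧ ∀ v ∈ V, p₁ ≤ v) ∧
      (∀ l ∈ L, ∀ u ∈ V, u ∉ L → l < u) := by
  classical
  let L : Set ℝ := {v | v ∈ V ∧ A.XA v = 1 ∧ h ≠ 1}
  have hLlen : ∀ v ∈ L, ∃ p, A.sched (A.bid v) = [p] := by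
    rintro v ⟨hv, h1, -⟩
    exact List.length_eq_one_iff.1 h1
  have hUlen : ∀ v ∈ V, v ∉ L → (A.sched (A.bid v)).length = h := by
    intro v hv hvL
    rcases hX v hv with h1 | h1
    · by_contra hne
      refine hvL ⟨hv, h1, fun h2 => hne ?_⟩
      exact h1.trans h2.symm
    · exact h1
  have hnn : ∀ v ∈ L, ∀ p, A.sched (A.bid v) = [p] → 0 ≤ p := by
    intro v hv p hp
    exact A.pay_nonneg _ (A.bid_mem v hv.1) p (by rw [hp]; simp)
  have hple : ∀ v ∈ L, ∀ p, A.sched (A.bid v) = [p] → p ≤ v := by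
    intro v hv p hp
    have := A.bid_IR v hv.1
    rwa [hp, filt_single p (hnn v hv p hp)] at this
  have key : ∀ v ∈ L, ∀ w ∈ L, ∀ p q, A.sched (A.bid v) = [p] → A.sched (A.bid w) = [q] →
      p ≤ w → q ≤ p := by
    intro v hv w hw p q hp hq hpw
    have := A.opt_bid hw.1 hv.1 (by rw [hp, filt_single p (hnn v hv p hp)]; exact hpw)
    rw [hp, hq] at this
    simp [util] at this
    linarith
  have hconst : ∀ v ∈ L, ∀ w ∈ L, ∀ p q, A.sched (A.bid v) = [p] → A.sched (A.bid w) = [q] →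
      v ≤ w → p = q := by
    intro v hv w hw p q hp hq hvw
    have h1 := key v hv w hw p q hp hq ((hple v hv p hp).trans hvw)
    have h2 := key w hw v hv q p hq hp (h1.trans (hple v hv p hp))
    exact le_antisymm h2 h1
  have hlt : ∀ l ∈ L, ∀ u ∈ V, u ∉ L → l < u := by
    intro w hw v hv hvL
    by_contra hcon
    push Not at hcon
    have hne : v ≠ w := fun h => hvL (h ▸ hw)
    have hvw : v < w := lt_of_le_of_ne hcon hne
    have h2 : 2 ≤ h := by have := hw.2.2; omega
    have h2' : (2:ℝ) ≤ h := by exact_mod_cast h2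
    obtain ⟨p, hp⟩ := hLlen w hw
    have h3 := A.opt_bid hw.1 hv ((A.bid_IR v hv).trans hvw.le)
    have h4 := A.sum_bid_le hv
    rw [hp] at h3
    unfold util at h3
    rw [hUlen v hv hvL] at h3 h4
    simp at h3
    rcases le_or_gt p v with hpv | hpv
    · have h5 := A.opt_bid hv hw.1 (by rw [hp, filt_single p (hnn w hw p hp)]; exact hpv)
      rw [hp] at h5
      unfold util at h5
      rw [hUlen v hv hvL] at h5
      simp at h5
      nlinarith
    · nlinarith
  by_cases hL : L.Nonempty
  · obtain ⟨l0, hl0⟩ := hL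
    obtain ⟨p, hp⟩ := hLlen l0 hl0
    have hall : ∀ v ∈ L, A.sched (A.bid v) = [p] := by
      intro v hv
      obtain ⟨q, hq⟩ := hLlen v hv
      rw [hq]
      rcases le_total v l0 with hle | hle
      · rw [hconst v hv l0 hl0 q p hq hp hle]
      · rw [hconst l0 hl0 v hv p q hp hq hle]
    refine ⟨L, p, fun v hv => hv.1, hall, hUlen, fun _ => ⟨?_, hnn l0 hl0 p hp, ?_⟩, hlt⟩
    · have := hl0.2.2; omega
    · intro v hv
      by_cases hvL : v ∈ L
      · exact hple v hvL p (hall v hvL)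
      · exact (hple l0 hl0 p hp).trans (hlt l0 hl0 v hv hvL).le
  · exact ⟨L, 0, fun v hv => hv.1, fun v hv => absurd ⟨v, hv⟩ hL, hUlen,
      fun h => absurd h hL, hlt⟩

/-- Extending a SWAC with allocations in `{1, h}` to one with allocations in `{1, h+1}`. -/
lemma exists_extension (hV : ∀ v ∈ V, 0 ≤ v) (hg0 : g 0 0 = 0) {a : ℝ → ℝ} {β : ℝ}
    (hga : ∀ v ∈ V, ∀ p, g v p = a v + β * p)
    {h : ℕ} (hh : 1 ≤ h) (A : SWAC h V) (L : Set ℝ) (p₁ : ℝ) (hLV : L ⊆ V)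
    (hL : ∀ v ∈ L, A.sched (A.bid v) = [p₁])
    (hU : ∀ v ∈ V, v ∉ L → (A.sched (A.bid v)).length = h)
    (hne : L.Nonempty → 2 ≤ h ∧ 0 ≤ p₁ ∧ ∀ v ∈ V, p₁ ≤ v)
    (hlt : ∀ l ∈ L, ∀ u ∈ V, u ∉ L → l < u) :
    ∃ A' : SWAC (h+1) V, TieFavor g (fun _ => 0) A' ∧
      (∀ v ∈ L, A'.sched (A'.bid v) = [p₁]) ∧
      (∀ v ∈ V, v ∉ L → (A'.sched (A'.bid v)).length = h + 1 ∧
        (A'.sched (A'.bid v)).sum = (h+1) / h * (A.sched (A.bid v)).sum) := by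
  classical
  have hh' : (1:ℝ) ≤ h := by exact_mod_cast hh
  have hh0 : (0:ℝ) < h := by linarith
  let P : ℝ → ℝ := fun v => (A.sched (A.bid v)).sum
  let T : ℝ → ℝ := fun v => (h+1) / h * P v
  have hT : ∀ v, h * T v = (h+1) * P v := fun v => by simp only [T]; field_simp
  have hP0 : ∀ v ∈ V, 0 ≤ P v := fun v hv => A.sum_bid_nonneg hv
  have hPT : ∀ v ∈ V, P v ≤ T v := fun v hv => by
    have := hT v; have := hP0 v hv; nlinarith
  have hTv : ∀ v ∈ V, v ∉ L → T v ≤ (h+1) * v := by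
    intro v hv hvL
    have h1 := A.sum_bid_le hv
    rw [hU v hv hvL] at h1
    have h2 : P v ≤ h * v := h1
    have := hT v
    have : h * T v ≤ h * ((h+1) * v) := by rw [this]; nlinarith
    exact le_of_mul_le_mul_left this hh0
  have htent : ∀ v, v ∈ V → v ∉ L → ∃ l : List ℝ, l.length = h+1 ∧ (∀ p ∈ l, 0 ≤ p) ∧
      l.sum = T v ∧ filt l = min v (T v) := by
    intro v hv hvL
    have hT0 : 0 ≤ T v := (hP0 v hv).trans (hPT v hv)
    apply exists_tent (h+1) (min v (T v)) (T v) (le_min (hV v hv) hT0) (min_le_right _ _)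
    push_cast
    rcases le_total v (T v) with hle | hle
    · rw [min_eq_left hle]; exact hTv v hv hvL
    · rw [min_eq_right hle]; nlinarith
  choose! s hs1 hs2 hs3 hs4 using htent
  let σ : ℝ → List ℝ := fun v => if v ∈ L then [p₁] else s v
  have hσL : ∀ v ∈ L, σ v = [p₁] := fun v hv => by simp [σ, hv]
  have hσU : ∀ v, v ∉ L → σ v = s v := fun v hv => by simp [σ, hv]
  have hfL : ∀ v ∈ L, filt (σ v) = p₁ := fun v hv => by
    rw [hσL v hv, filt_single _ (hne ⟨v, hv⟩).2.1]
  have huL : ∀ w ∈ L, ∀ v, util (σ w) v = v - p₁ := fun w hw v => by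
    rw [hσL w hw]; simp [util]
  have huU : ∀ w ∈ V, w ∉ L → ∀ v, util (σ w) v = (h+1) * v - T w := fun w hw hwL v => by
    rw [hσU w hwL]; simp [util, hs1 w hw hwL, hs3 w hw hwL]
  -- an agent outside `L` strictly prefers the long bid
  have hUL : ∀ v ∈ V, v ∉ L → ∀ w ∈ L, v - p₁ < (h+1) * v - T v := by
    intro v hv hvL w hw
    obtain ⟨-, hp0, hpv⟩ := hne ⟨w, hw⟩
    have h1 := A.opt_bid hv (hLV hw) (by rw [hL w hw, filt_single _ hp0]; exact hpv v hv)
    rw [hL w hw] at h1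
    unfold util at h1
    rw [hU v hv hvL] at h1
    simp at h1
    have h2 : p₁ < v := (hpv w (hLV hw)).trans_lt (hlt w hw v hv hvL)
    have h3 : v - p₁ ≤ h * v - P v := by simp only [P]; linarith
    have h4 := hT v
    have h5 : h * ((h+1) * v - T v) = (h+1) * (h * v - P v) := by rw [mul_sub, h4]; ring
    have h6 : h * (v - p₁) < h * ((h+1) * v - T v) := by rw [h5]; nlinarith
    exact lt_of_mul_lt_mul_left h6 hh0.le
  have hUU : ∀ v ∈ V, v ∉ L → ∀ w ∈ V, w ∉ L → min w (T w) ≤ v → T v ≤ T w := by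
    intro v hv hvL w hw hwL hmin
    have hf : filt (A.sched (A.bid w)) ≤ v := by
      refine le_trans (le_min (A.bid_IR w hw) ?_) hmin
      exact (filt_le_sum _ (A.pay_nonneg _ (A.bid_mem w hw))).trans (hPT w hw)
    have h1 := A.opt_bid hv hw hf
    unfold util at h1
    rw [hU v hv hvL, hU w hw hwL] at h1
    have h2 : P v ≤ P w := by simp only [P]; linarith
    have h3 : h * T v ≤ h * T w := by rw [hT, hT]; nlinarith
    exact le_of_mul_le_mul_left h3 hh0
  -- an agent in `L` only ever sees a long bid if `v = 0`
  have hLU : ∀ v ∈ L, ∀ w ∈ V, w ∉ L → min w (T w) ≤ v → v = 0 ∧ T w = 0 ∧ p₁ = 0 := by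
    intro v hv w hw hwL hmin
    obtain ⟨h2, hp0, hpv⟩ := hne ⟨v, hv⟩
    have h2' : (2:ℝ) ≤ h := by exact_mod_cast h2
    have hvw := hlt v hv w hw hwL
    have hTle : T w ≤ v := by
      rcases min_le_iff.1 hmin with h | h
      · linarith
      · exact h
    have hf : filt (A.sched (A.bid w)) ≤ v :=
      ((filt_le_sum _ (A.pay_nonneg _ (A.bid_mem w hw))).trans (hPT w hw)).trans hTle
    have h1 := A.opt_bid (hLV hv) hw hf
    rw [hL v hv] at h1
    unfold util at h1
    rw [hU w hw hwL] at h1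
    simp at h1
    have h3 : h * v - P w ≤ v - p₁ := by simp only [P]; linarith
    have h4 := hT w
    have hv0 := hV v (hLV hv)
    have h6 : (h+1) * P w ≤ h * v := by rw [← h4]; nlinarith
    have h7 : (h+1) * ((h-1) * v) ≤ h * v := by
      have : (h-1) * v ≤ P w := by linarith
      nlinarith
    have h7' : (1:ℝ) ≤ (h+1)*(h-1) - h := by nlinarith
    have h8 : v = 0 := le_antisymm (by nlinarith) hv0
    have h9 := hpv v (hLV hv)
    have h10 := (hP0 w hw).trans (hPT w hw)
    exact ⟨h8, by linarith, by linarith⟩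
  let A' : SWAC (h+1) V := SWAC.direct V (h+1) σ
    (fun v hv => by
      by_cases hvL : v ∈ L
      · rw [hσL v hvL]; simp
      · rw [hσU v hvL, hs1 v hv hvL])
    (fun v hv p hp => by
      by_cases hvL : v ∈ L
      · rw [hσL v hvL] at hp
        rw [List.mem_singleton.1 hp]; exact (hne ⟨v, hvL⟩).2.1
      · rw [hσU v hvL] at hp; exact hs2 v hv hvL p hp)
    (fun v hv => by
      by_cases hvL : v ∈ L
      · rw [hfL v hvL]; exact (hne ⟨v, hvL⟩).2.2 v hv
      · rw [hσU v hvL, hs4 v hv hvL]; exact min_le_left _ _)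
    (fun v hv w hw hf => by
      by_cases hvL : v ∈ L
      · rw [huL v hvL]
        by_cases hwL : w ∈ L
        · rw [huL w hwL]
        · rw [hσU w hwL, hs4 w hw hwL] at hf
          obtain ⟨e1, e2, e3⟩ := hLU v hvL w hw hwL hf
          rw [huU w hw hwL, e1, e2, e3]; simp
      · rw [huU v hv hvL]
        by_cases hwL : w ∈ L
        · rw [huL w hwL]; exact (hUL v hv hvL w hwL).le
        · rw [huU w hw hwL]
          rw [hσU w hwL, hs4 w hw hwL] at hf
          have := hUU v hv hvL w hw hwL hf
          linarith)
  refine ⟨A', ?_, hσL, ?_⟩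
  · intro v hv w hw hf hu
    change gross g v (σ w) - 0 ≤ gross g v (σ v) - 0
    change filt (σ w) ≤ v at hf
    change util (σ w) v = util (σ v) v at hu
    rw [gross_eq (hga v hv), gross_eq (hga v hv)]
    by_cases hvL : v ∈ L
    · by_cases hwL : w ∈ L
      · rw [hσL v hvL, hσL w hwL]
      · rw [hσU w hwL, hs4 w hw hwL] at hf
        obtain ⟨e1, e2, e3⟩ := hLU v hvL w hw hwL hf
        have ha0 : a v = 0 := by
          have := hga v hv 0
          rw [e1] at this ⊢
          rw [hg0] at this; linarith
        rw [hσL v hvL, hσU w hwL, hs3 w hw hwL, e2, e3, ha0]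
        simp
    · by_cases hwL : w ∈ L
      · rw [huL w hwL, huU v hv hvL] at hu
        exact absurd hu (hUL v hv hvL w hwL).ne
      · rw [huU w hw hwL, huU v hv hvL] at hu
        rw [hσU w hwL, hσU v hvL, hs3 w hw hwL, hs3 v hv hvL, hs1 w hw hwL, hs1 v hv hvL]
        have : T w = T v := by linarith
        rw [this]
  · intro v hv hvL
    change (σ v).length = h + 1 ∧ (σ v).sum = T v
    rw [hσU v hvL]
    exact ⟨hs1 v hv hvL, hs3 v hv hvL⟩


lemma integral_split {D : Measure ℝ} (hD : D Vᶜ = 0) {S : Set ℝ} (hS : MeasurableSet S)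
    {φ f₁ f₂ : ℝ → ℝ} (h₁ : ∀ v ∈ V, v ∈ S → φ v = f₁ v) (h₂ : ∀ v ∈ V, v ∉ S → φ v = f₂ v)
    (hf₁ : IntegrableOn f₁ S D) (hf₂ : IntegrableOn f₂ Sᶜ D) :
    ∫ v, φ v ∂D = (∫ v in S, f₁ v ∂D) + ∫ v in Sᶜ, f₂ v ∂D := by
  have e₁ : f₁ =ᵐ[D.restrict S] φ := by
    rw [Filter.EventuallyEq, ae_restrict_iff' hS]
    filter_upwards [ae_mem_of_null hD] with v hv hvS
    exact (h₁ v hv hvS).symm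
  have e₂ : f₂ =ᵐ[D.restrict Sᶜ] φ := by
    rw [Filter.EventuallyEq, ae_restrict_iff' hS.compl]
    filter_upwards [ae_mem_of_null hD] with v hv hvS
    exact (h₂ v hv hvS).symm
  have i₁ : IntegrableOn φ S D := hf₁.congr e₁
  have i₂ : IntegrableOn φ Sᶜ D := hf₂.congr e₂
  have i : Integrable φ D := by
    have := i₁.union i₂
    rwa [Set.union_compl_self, integrableOn_univ] at this
  rw [← integral_add_compl hS i, integral_congr_ae e₁, integral_congr_ae e₂]

/-- The value obtained from agents in a low set `S` at a price accepted by everybody is at most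
the mass of `S` times any bound on the total value. -/
lemma low_part_le {D : Measure ℝ} [IsProbabilityMeasure D] (hD : D Vᶜ = 0) {a : ℝ → ℝ}
    (haV : MonotoneOn a V) (hint : Integrable a D) {S : Set ℝ} (hS : MeasurableSet S)
    (hSne : (V ∩ S).Nonempty) (hlt : ∀ l ∈ V, l ∈ S → ∀ u ∈ V, u ∉ S → l ≤ u) {ρ q : ℝ}
    (hρ : ∫ v, (a v + q) ∂D ≤ ρ) :
    ∫ v in S, (a v + q) ∂D ≤ D.real S * ρ := by
  have hi : Integrable (fun v => a v + q) D := hint.add (integrable_const _)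
  have hsum := integral_add_compl hS hi
  have hm : D.real S + D.real Sᶜ = 1 := by
    rw [measureReal_add_measureReal_compl hS]; simp
  have hm0 : 0 ≤ D.real S := measureReal_nonneg
  have hm1 : 0 ≤ D.real Sᶜ := measureReal_nonneg
  by_cases hU : (V ∩ Sᶜ).Nonempty
  · obtain ⟨u0, hu0, hu0S⟩ := hU
    have hbd : BddAbove (a '' (V ∩ S)) := ⟨a u0, by
      rintro _ ⟨l, hl, rfl⟩
      exact haV hl.1 hu0 (hlt l hl.1 hl.2 u0 hu0 hu0S)⟩
    set s := sSup (a '' (V ∩ S)) with hs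
    have h1 : ∫ v in S, (a v + q) ∂D ≤ ∫ _ in S, (s + q) ∂D := by
      apply integral_mono_ae hi.integrableOn (integrable_const _)
      rw [Filter.EventuallyLE, ae_restrict_iff' hS]
      filter_upwards [ae_mem_of_null hD] with v hv hvS
      have := le_csSup hbd ⟨v, ⟨hv, hvS⟩, rfl⟩
      linarith
    have h2 : ∫ _ in Sᶜ, (s + q) ∂D ≤ ∫ v in Sᶜ, (a v + q) ∂D := by
      apply integral_mono_ae (integrable_const _) hi.integrableOn
      rw [Filter.EventuallyLE, ae_restrict_iff' hS.compl]
      filter_upwards [ae_mem_of_null hD] with v hv hvS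
      have : s ≤ a v := csSup_le (hSne.image a) (by
        rintro _ ⟨l, hl, rfl⟩
        exact haV hl.1 hv (hlt l hl.1 hl.2 v hv hvS))
      linarith
    rw [setIntegral_const, smul_eq_mul] at h1 h2
    have e : D.real Sᶜ = 1 - D.real S := by linarith
    rw [e] at h2 hm1
    nlinarith
  · have h0 : D Sᶜ = 0 := measure_mono_null (fun v hv hvV => hU ⟨v, hvV, hv⟩) hD
    have h1 : ∫ v in Sᶜ, (a v + q) ∂D = 0 := by
      rw [Measure.restrict_eq_zero.2 h0]; simp
    have h2 : D.real Sᶜ = 0 := by simp [measureReal_def, h0]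
    have h3 : D.real S = 1 := by linarith
    rw [h3]; linarith

lemma step {D : Measure ℝ} [IsProbabilityMeasure D] (hV : ∀ v ∈ V, 0 ≤ v)
    (hg0 : g 0 0 = 0)
    (hD : D Vᶜ = 0) {a : ℝ → ℝ} {β : ℝ} (haV : MonotoneOn a V)
    (hga : ∀ v ∈ V, ∀ p, g v p = a v + β * p)
    (hint : Integrable a D) {k : ℕ}
    (hb1 : BddAbove {x : ℝ | ∃ M : Mech V g, x = mechER V g (fun _ => D) M 1 []})
    (hb2 : BddAbove {x : ℝ | ∃ M : Mech V g, x = mechER V g (fun _ => D) M (k+1+1) []})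
    (A : SWAC (k+1) V) (hX : ∀ v ∈ V, A.XA v = 1 ∨ A.XA v = k+1)
    (hup : optRental V g (fun _ => D) (k+1) ≤ optRental V g (fun _ => D) k +
      ER D g (overTimeCost V g (fun _ => D) (k+1)) A)
    (ih : 1 ≤ k → k * optRental V g (fun _ => D) 1 ≤ optRental V g (fun _ => D) k ∧
      (k+1) * optRental V g (fun _ => D) k ≤ k * optRental V g (fun _ => D) (k+1)) :
    (k+2) * optRental V g (fun _ => D) (k+1) ≤ (k+1) * optRental V g (fun _ => D) (k+1+1) := by
  obtain ⟨L, p₁, hLV, hL, hU, hne, hlt⟩ := exists_structure (Nat.succ_pos k) A hX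
  obtain ⟨A', htie, hL', hU'⟩ :=
    exists_extension hV hg0 hga (Nat.succ_pos k) A L p₁ hLV hL hU hne hlt
  set S : Set ℝ := (lowerClosure L : Set ℝ) with hSdef
  have hS : MeasurableSet S := (lowerClosure L).lower.ordConnected.measurableSet
  have hSL : ∀ v ∈ V, v ∈ S → v ∈ L := by
    intro v hv hvS
    obtain ⟨l, hl, hvl⟩ := mem_lowerClosure.1 hvS
    by_contra hvL
    exact absurd hvl (not_le.2 (hlt l hl v hv hvL))
  have hLS : ∀ v, v ∉ S → v ∉ L := fun v hvS hvL => hvS (subset_lowerClosure hvL)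
  set R : ℕ → ℝ := fun j => optRental V g (fun _ => D) j with hR
  set P : ℝ → ℝ := fun v => (A.sched (A.bid v)).sum with hP
  have hPm : AEMeasurable P (D.restrict Sᶜ) := by
    have : AEMeasurable (fun v => - P v) (D.restrict Sᶜ) := by
      apply aemeasurable_of_monotoneOn hD hS.compl
      rintro v ⟨hv, hvS⟩ w ⟨hw, hwS⟩ hvw
      have h1 := A.opt_bid hw hv ((A.bid_IR v hv).trans hvw)
      unfold util at h1
      rw [hU v hv (hLS v hvS), hU w hw (hLS w hwS)] at h1
      simp only [P]
      linarith
    have h2 := this.neg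
    have e : (-fun v => - P v) = P := by ext v; simp
    rwa [e] at h2
  have hPi : IntegrableOn P Sᶜ D := by
    obtain ⟨K, hK0, hK⟩ := A.exists_bound
    refine Integrable.mono' (integrable_const K) hPm.aestronglyMeasurable ?_
    rw [ae_restrict_iff' hS.compl]
    filter_upwards [ae_mem_of_null hD] with v hv _
    rw [Real.norm_eq_abs, abs_of_nonneg (A.sum_bid_nonneg hv)]
    exact hK v hv
  have haS : ∀ T : Set ℝ, IntegrableOn a T D := fun T => hint.integrableOn
  have hfL : IntegrableOn (fun v => a v + β * p₁) S D := (haS S).add (integrable_const _)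
  have hfG : IntegrableOn (fun v => ((k:ℝ)+1) * a v + β * P v) Sᶜ D :=
    ((haS _).const_mul _).add (hPi.const_mul _)
  set EL := ∫ v in S, (a v + β * p₁) ∂D with hEL
  set EG := ∫ v in Sᶜ, (((k:ℝ)+1) * a v + β * P v) ∂D with hEG
  set lam := D.real S with hlam
  have hlam0 : 0 ≤ lam := measureReal_nonneg
  have hm : lam + D.real Sᶜ = 1 := by
    rw [hlam, measureReal_add_measureReal_compl hS]; simp
  have hk1 : ((k:ℝ)+1) ≠ 0 := by positivity
  have hLempty : k = 0 → S = ∅ := by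
    intro hk
    have : L = ∅ := by
      by_contra hcon
      have := (hne (Set.nonempty_iff_ne_empty.2 hcon)).1
      omega
    rw [hSdef, this]; simp
  have hR0 : R 0 = 0 := optRental_zero _ hV
  -- upper bound
  have hER : ER D g (overTimeCost V g (fun _ => D) (k+1)) A = EL + (EG - (1 - lam) * R k) := by
    have := integral_split hD hS (φ := fun v => A.R g (overTimeCost V g (fun _ => D) (k+1)) v)
      (f₁ := fun v => a v + β * p₁)
      (f₂ := fun v => (((k:ℝ)+1) * a v + β * P v) - R k) ?_ ?_ hfL
      (hfG.sub (integrable_const _))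
    · unfold ER
      rw [this, integral_sub hfG (integrable_const _), setIntegral_const, smul_eq_mul]
      rw [show D.real Sᶜ = 1 - lam by linarith]
    · intro v hv hvS
      simp only [SWAC.R, SWAC.r, SWAC.X]
      rw [gross_eq (hga v hv), hL v (hSL v hv hvS)]
      simp [overTimeCost]
    · intro v hv hvS
      simp only [SWAC.R, SWAC.r, SWAC.X]
      rw [gross_eq (hga v hv), hU v hv (hLS v hvS)]
      have : max (k+1) 1 = k+1 := by simp
      simp only [overTimeCost, this, Nat.sub_self, Nat.add_sub_cancel]
      have h0 : optRental V g (fun _ => D) 0 = 0 := hR0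
      rw [h0]
      push_cast
      simp only [R, P]
      ring
  have hupper : R (k+1) ≤ EL + EG + lam * R k := by
    have : R (k+1) ≤ R k + ER D g (overTimeCost V g (fun _ => D) (k+1)) A := hup
    rw [hER] at this
    linarith
  -- lower bound
  have hlowM : ∀ M : Mech V g,
      EL + lam * mechER V g (fun _ => D) M (k+1) [] + (k+2)/(k+1) * EG ≤ R (k+1+1) := by
    intro M
    obtain ⟨M', hM'⟩ := exists_prepend (fun _ => D) hV M (k+1) A' _ htie
    have h1 := mechER_le_optRental (fun _ => D) (k+1+1) hb2 M' []
    rw [hM'] at h1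
    refine le_trans (le_of_eq ?_) h1
    symm
    rw [integral_split hD hS
      (f₁ := fun v => (a v + β * p₁) + mechER V g (fun _ => D) M (k+1) [])
      (f₂ := fun v => (k+2)/(k+1) * (((k:ℝ)+1) * a v + β * P v)) ?_ ?_
      (hfL.add (integrable_const _)) (hfG.const_mul _)]
    · rw [integral_add hfL (integrable_const _), setIntegral_const, smul_eq_mul,
        integral_const_mul]
    · intro v hv hvS
      have hs := hL' v (hSL v hv hvS)
      rw [gross_eq (hga v hv)]
      simp only [SWAC.XA, SWAC.X]
      rw [hs]
      simp
    · intro v hv hvS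
      obtain ⟨e1, e2⟩ := hU' v hv (hLS v hvS)
      rw [gross_eq (hga v hv)]
      simp only [SWAC.XA, SWAC.X]
      rw [e1, e2]
      have : max (k+1+1) 1 = k+1+1 := by simp
      rw [this, Nat.sub_self, mechER_zero]
      push_cast
      simp only [P]
      field_simp
      ring
  have hlow : EL + lam * R (k+1) + (k+2)/(k+1) * EG ≤ R (k+1+1) := by
    rcases hlam0.eq_or_lt with h0 | h0
    · have := hlowM (nullMech V hV g)
      rw [← h0] at this ⊢
      linarith
    · have : R (k+1) ≤ (R (k+1+1) - EL - (k+2)/(k+1) * EG) / lam := by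
        refine csSup_le ⟨_, nullMech V hV g, rfl⟩ ?_
        rintro x ⟨M, rfl⟩
        rw [le_div_iff₀ h0]
        have := hlowM M
        linarith
      rw [le_div_iff₀ h0] at this
      linarith
  -- the low agents
  have hone : EL ≤ lam * R 1 := by
    by_cases hLe : L.Nonempty
    · obtain ⟨h2, hp0, hpv⟩ := hne hLe
      have hone' : ∫ v, (a v + β * p₁) ∂D ≤ R 1 := by
        let C : SWAC (0+1) V := SWAC.const V (0+1) [p₁] (by simp) (by simpa using hp0)
          (fun v hv => by rw [filt_single _ hp0]; exact hpv v hv)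
        obtain ⟨M', hM'⟩ := exists_prepend (fun _ => D) hV (nullMech V hV g) 0 C
          (fun _ => 0) (SWAC.const_tie _ _ _ _ _ _ _)
        have h1 := mechER_le_optRental (fun _ => D) (0+1) hb1 M' []
        rw [hM'] at h1
        refine le_trans (le_of_eq ?_) h1
        apply integral_congr_ae
        filter_upwards [ae_mem_of_null hD] with v hv
        have e : C.sched (C.bid v) = [p₁] := rfl
        rw [gross_eq (hga v hv)]
        rw [e, mechER_null]
        simp
      obtain ⟨l0, hl0⟩ := hLe
      exact low_part_le hD haV hint hS ⟨l0, hLV hl0, subset_lowerClosure hl0⟩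
        (fun l hl hlS u hu huS => (hlt l (hSL l hl hlS) u hu (hLS u huS)).le) hone'
    · have : L = ∅ := Set.not_nonempty_iff_eq_empty.1 hLe
      have hS0 : S = ∅ := by rw [hSdef, this]; simp
      rw [hEL, hlam, hS0]; simp
  have hlow' : ((k:ℝ)+1) * (EL + lam * R (k+1)) + (k+2) * EG ≤ (k+1) * R (k+1+1) := by
    have hkp : (0:ℝ) ≤ (k:ℝ)+1 := by positivity
    have := mul_le_mul_of_nonneg_left hlow hkp
    refine le_trans (le_of_eq ?_) this
    field_simp
  change (k+2) * R (k+1) ≤ (k+1) * R (k+1+1)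
  rcases Nat.eq_zero_or_pos k with hk | hk
  · have hS0 := hLempty hk
    have h1 : lam = 0 := by rw [hlam, hS0]; simp
    have h2 : EL = 0 := by rw [hEL, hS0]; simp
    rw [h1, h2] at hupper hlow'
    have : (0:ℝ) ≤ k := Nat.cast_nonneg k
    nlinarith
  · obtain ⟨i1, i2⟩ := ih hk
    change k * R 1 ≤ R k at i1
    change (k+1) * R k ≤ k * R (k+1) at i2
    have hkp : (0:ℝ) < k := by exact_mod_cast hk
    have h1 : k * EL ≤ lam * R k := by nlinarith
    have h2 : lam * ((k+1) * R k) ≤ lam * (k * R (k+1)) := mul_le_mul_of_nonneg_left i2 hlam0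
    have h3 := mul_le_mul_of_nonneg_left hupper (by positivity : (0:ℝ) ≤ k * (k+2))
    have h4 := mul_le_mul_of_nonneg_left hlow' hkp.le
    refine le_of_mul_le_mul_left ?_ hkp
    nlinarith

end Helpers

/-- Consider the rental game with i.i.d. valuations from `D` and
a reward function `g` (normalized, nondecreasing in the valuation, linear in the
payment), with the associated over-time cost functions.  If for every horizon
`1 ≤ h ≤ n` there exists an optimal `(h, D, g, c^D_{h,g})`-SWAC in which every
agent's allocation lies in `{1, h}`, then the expected average daily reward is
nondecreasing in the horizon: `R_m / m ≤ R_n / n` for all `1 ≤ m < n`. -/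
theorem average_reward_monotone_in_horizon
    (n : ℕ) (V : Set ℝ) (hV : ∀ v ∈ V, 0 ≤ v)
    (g : ℝ → ℝ → ℝ) (hg0 : g 0 0 = 0)
    (hgmono : ∀ p : ℝ, MonotoneOn (fun v => g v p) V)
    (hglin : ∀ v ∈ V, ∃ a b : ℝ, ∀ p : ℝ, g v p = a + b * p)
    (D : Measure ℝ) [IsProbabilityMeasure D] (hDsupp : D Vᶜ = 0)
    (hex : ∀ h, 1 ≤ h → h ≤ n → ∃ A : SWAC h V,
      Optimal D g (overTimeCost V g (fun _ => D) h) A ∧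
      ∀ v ∈ V, A.XA v = 1 ∨ A.XA v = h) :
    ∀ m, 1 ≤ m → m < n →
      optRental V g (fun _ => D) m / (m : ℝ) ≤ optRental V g (fun _ => D) n / (n : ℝ) := by
  have hVne : V.Nonempty := by
    by_contra hcon
    rw [Set.not_nonempty_iff_eq_empty] at hcon
    rw [hcon] at hDsupp
    simp at hDsupp
  obtain ⟨v0, hv0⟩ := hVne
  obtain ⟨a0, β, hab⟩ := hglin v0 hv0
  set a : ℝ → ℝ := fun v => g v 0 with ha_def
  have hga : ∀ v ∈ V, ∀ p, g v p = a v + β * p := by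
    intro v hv p
    obtain ⟨a1, b1, h1⟩ := hglin v hv
    have e : b1 = β := by
      have key : ∀ t : ℝ, ∀ x y : ℝ, (∀ p : ℝ, 0 ≤ t + (x - y) * p) → x = y := by
        intro t x y hxy
        by_contra hne
        have hne' : x - y ≠ 0 := sub_ne_zero.2 hne
        have := hxy ((- t - 1) / (x - y))
        rw [mul_div_cancel₀ _ hne'] at this
        linarith
      rcases le_total v v0 with hle | hle
      · refine (key (a0 - a1) β b1 fun p => ?_).symm
        have : g v p ≤ g v0 p := hgmono p hv hv0 hle
        rw [h1, hab] at this
        linarith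
      · refine key (a1 - a0) b1 β fun p => ?_
        have : g v0 p ≤ g v p := hgmono p hv0 hv hle
        rw [h1, hab] at this
        linarith
    simp only [a]
    rw [h1, h1, e]
    ring
  have haV : MonotoneOn a V := hgmono 0
  have ha : AEMeasurable a D := by
    have := aemeasurable_of_monotoneOn hDsupp MeasurableSet.univ (f := a) (by simpa using haV)
    simpa using this
  intro m hm1 hmn
  by_cases hap : Integrable (fun v => max (a v) 0) D
  swap
  · have hz : ∀ h, optRental V g (fun _ => D) h = 0 := by
      intro h
      refine le_antisymm (Real.sSup_le ?_ le_rfl) (optRental_nonneg _ hV h)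
      rintro x ⟨M, rfl⟩
      rw [mechER_degenerate hDsupp haV hga ha hap]
    rw [hz, hz]; simp
  have hbdd : ∀ h ≤ n,
      BddAbove {x : ℝ | ∃ M : Mech V g, x = mechER V g (fun _ => D) M h []} := by
    intro h
    induction h using Nat.strong_induction_on with
    | _ h ih =>
      intro hn
      rcases h with _ | h
      · exact ⟨0, by rintro x ⟨M, rfl⟩; rw [mechER_zero]⟩
      · obtain ⟨A, hA, -⟩ := hex (h+1) (Nat.succ_pos h) hn
        refine ⟨optRental V g (fun _ => D) h +
          ER D g (overTimeCost V g (fun _ => D) (h+1)) A, ?_⟩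
        rintro x ⟨M, rfl⟩
        exact mechER_le hV hDsupp hga ha hap
          (fun k hk => ih k (Nat.lt_succ_of_le hk) (by omega)) A hA M []
  have hup : ∀ h, h + 1 ≤ n → ∀ A : SWAC (h+1) V,
      Optimal D g (overTimeCost V g (fun _ => D) (h+1)) A →
      optRental V g (fun _ => D) (h+1) ≤ optRental V g (fun _ => D) h +
        ER D g (overTimeCost V g (fun _ => D) (h+1)) A := by
    intro h hn A hA
    refine csSup_le ⟨_, nullMech V hV g, rfl⟩ ?_
    rintro x ⟨M, rfl⟩
    exact mechER_le hV hDsupp hga ha hap (fun k hk => hbdd k (by omega)) A hA M []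
  by_cases hint : Integrable a D
  swap
  · have hz : ∀ h ≤ n, optRental V g (fun _ => D) h = 0 := by
      intro h
      induction h with
      | zero => intro _; exact optRental_zero _ hV
      | succ h ih =>
        intro hn
        obtain ⟨A, hA, hX⟩ := hex (h+1) (Nat.succ_pos h) hn
        have h1 := hup h hn A hA
        rw [ih (by omega), ER_eq_zero hDsupp hga ha hint A _ (fun v hv => by
          rcases hX v hv with h | h <;> omega)] at h1
        exact le_antisymm (by linarith) (optRental_nonneg _ hV _)
    rw [hz m hmn.le, hz n le_rfl]; simp
  have hone : ∀ h, h ≤ n →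
      (1 ≤ h → h * optRental V g (fun _ => D) 1 ≤ optRental V g (fun _ => D) h) ∧
      (h + 1 ≤ n → (h+1) * optRental V g (fun _ => D) h ≤
        h * optRental V g (fun _ => D) (h+1)) := by
    intro h
    induction h with
    | zero =>
      intro _
      refine ⟨fun h => absurd h (by omega), fun _ => ?_⟩
      rw [optRental_zero _ hV]; simp
    | succ k ih =>
      intro hn
      obtain ⟨i1, i2⟩ := ih (by omega)
      have i2' := i2 hn
      refine ⟨fun _ => ?_, fun hn2 => ?_⟩
      · rcases Nat.eq_zero_or_pos k with hk | hk
        · subst hk; simp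
        · have i1' := i1 hk
          have hkp : (0:ℝ) < k := by exact_mod_cast hk
          push_cast
          refine le_of_mul_le_mul_left ?_ hkp
          nlinarith
      · obtain ⟨A, hA, hX⟩ := hex (k+1) (Nat.succ_pos k) hn
        have := step hV hg0 hDsupp haV hga hint (hbdd 1 (by omega)) (hbdd _ hn2) A hX
          (hup k hn A hA) (fun hk => ⟨i1 hk, i2'⟩)
        push_cast
        rw [add_assoc (k:ℝ) 1 1, one_add_one_eq_two]
        exact this
  have hstep : ∀ j, m + j ≤ n →
      optRental V g (fun _ => D) m / (m : ℝ) ≤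
        optRental V g (fun _ => D) (m + j) / ((m + j : ℕ) : ℝ) := by
    intro j
    induction j with
    | zero => intro _; simp
    | succ j ih =>
      intro hn
      refine (ih (by omega)).trans ?_
      have h1 := (hone (m + j) (by omega)).2 hn
      have hp : (0:ℝ) < ((m + j : ℕ) : ℝ) := by exact_mod_cast (by omega : 0 < m + j)
      have hp' : (0:ℝ) < ((m + (j + 1) : ℕ) : ℝ) := by exact_mod_cast (by omega : 0 < m + (j+1))
      rw [div_le_div_iff₀ hp hp']
      have e : ((m + (j + 1) : ℕ) : ℝ) = ((m + j : ℕ) : ℝ) + 1 := by push_cast; ring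
      rw [e]
      have e2 : m + (j + 1) = m + j + 1 := rfl
      rw [e2]
      linarith
  have := hstep (n - m) (by omega)
  rwa [show m + (n - m) = n by omega] at this

end RentalGame
end

section
/- For the n-day rental game with i.i.d. valuations uniform on [0,1] and consumer-surplus reward g(v,p) = v − p, the optimal expected reward R_n satisfies lim_{n→∞} R_n/n = 1. Consequently, since the optimal expected reward among fixed-rate rental mechanisms equals n/2, the ratio between the expected reward of the optimal rental mechanism and that of the optimal fixed-rate rental mechanism tends to 2 as n → ∞. -/
open MeasureTheory Filter

namespace RentalGame

/-- The uniform distribution on `[0,1]`. -/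
noncomputable def unif01 : Measure ℝ := volume.restrict (Set.Icc (0 : ℝ) 1)

/-- Consumer surplus reward `g(v,p) = v − p`. -/
noncomputable def csg : ℝ → ℝ → ℝ := fun v p => v - p

lemma foldr_max_le_s19 (l : List ℝ) (v : ℝ) :
    l.foldr max 0 ≤ v ↔ 0 ≤ v ∧ ∀ a ∈ l, a ≤ v := by
  induction l with
  | nil => simp
  | cons a l ih =>
    simp only [List.foldr_cons, max_le_iff, ih, List.mem_cons, forall_eq_or_imp]
    tauto

lemma filt_le (l : List ℝ) (v : ℝ) :
    filt l ≤ v ↔ 0 ≤ v ∧ ∀ k < l.length, (l.take (k + 1)).sum / ((k : ℝ) + 1) ≤ v := by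
  unfold filt
  rw [foldr_max_le_s19]
  simp

lemma util_nonneg (l : List ℝ) (v : ℝ) (h : filt l ≤ v) : 0 ≤ util l v := by
  rw [filt_le] at h
  obtain ⟨_, h2⟩ := h
  unfold util
  rcases Nat.eq_zero_or_pos l.length with h0 | h0
  · have := List.length_eq_zero_iff.mp h0
    subst this; simp
  · have := h2 (l.length - 1) (by omega)
    rw [Nat.sub_add_cancel h0, List.take_length, div_le_iff₀ (by positivity)] at this
    have e : ((l.length - 1 : ℕ) : ℝ) + 1 = l.length := by
      rw [Nat.cast_sub h0]; push_cast; ring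
    rw [e] at this
    linarith

lemma gross_csg (v : ℝ) (l : List ℝ) : gross csg v l = util l v := by
  unfold gross util csg
  induction l with
  | nil => simp
  | cons a l ih =>
    simp only [List.map_cons, List.sum_cons, ih, List.length_cons]
    push_cast; ring

lemma integral_unif_le (f : ℝ → ℝ) (g : ℝ → ℝ) (C : ℝ) (hC : 0 ≤ C)
    (hg : Integrable g unif01) (hgC : ∫ v, g v ∂unif01 ≤ C)
    (h : ∀ v ∈ Set.Icc (0 : ℝ) 1, f v ≤ g v) : ∫ v, f v ∂unif01 ≤ C := by
  by_cases hf : Integrable f unif01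
  · refine le_trans (integral_mono_ae hf hg ?_) hgC
    exact (ae_restrict_iff' measurableSet_Icc).mpr (Eventually.of_forall h)
  · rw [integral_undef hf]; exact hC

instance : IsProbabilityMeasure unif01 := by
  constructor
  simp [unif01]

lemma mechER_succ (M : Mech (Set.Icc (0 : ℝ) 1) csg) (h : ℕ) (hist : List ℝ) :
    mechER (Set.Icc (0 : ℝ) 1) csg (fun _ => unif01) M (h + 1) hist =
    ∫ v, (util ((M.au (h + 1) hist).sched ((M.au (h + 1) hist).bid v)) v +
        mechER (Set.Icc (0 : ℝ) 1) csg (fun _ => unif01) M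
          ((h + 1) - max ((M.au (h + 1) hist).sched ((M.au (h + 1) hist).bid v)).length 1)
          (hist ++ [(M.au (h + 1) hist).bid v])) ∂unif01 := by
  rw [mechER]
  simp only [gross_csg]
  rfl

lemma mechER_zero_s19 (M : Mech (Set.Icc (0 : ℝ) 1) csg) (hist : List ℝ) :
    mechER (Set.Icc (0 : ℝ) 1) csg (fun _ => unif01) M 0 hist = 0 := by
  rw [mechER]

lemma cast_sub_max (h x : ℕ) (hx : x ≤ h + 1) :
    ((h + 1 - max x 1 : ℕ) : ℝ) = (h : ℝ) + 1 - max (x : ℝ) 1 := by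
  rw [Nat.cast_sub (by omega)]
  push_cast; ring

/-- Trivial upper bound. -/
lemma mechER_le_s19 (M : Mech (Set.Icc (0 : ℝ) 1) csg) (h : ℕ) : ∀ (hist : List ℝ),
    mechER (Set.Icc (0 : ℝ) 1) csg (fun _ => unif01) M h hist ≤ h := by
  induction h using Nat.strong_induction_on with
  | _ h ih =>
    intro hist
    rcases h with _ | h
    · rw [mechER_zero_s19]; simp
    rw [mechER_succ]
    refine integral_unif_le _ (fun _ => ((h + 1 : ℕ) : ℝ)) _ (by positivity)
      (integrable_const _) (by simp) ?_
    intro v hv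
    set A := M.au (h + 1) hist with hA
    have hB := A.bid_mem v hv
    have hlen := A.len_le _ hB
    have h1 := ih (h + 1 - max (A.sched (A.bid v)).length 1) (by omega) (hist ++ [A.bid v])
    rw [cast_sub_max _ _ hlen] at h1
    have h2 : util (A.sched (A.bid v)) v ≤ (A.sched (A.bid v)).length := by
      unfold util
      have : 0 ≤ (A.sched (A.bid v)).sum := List.sum_nonneg (A.pay_nonneg _ hB)
      have h3 : ((A.sched (A.bid v)).length : ℝ) * v ≤ (A.sched (A.bid v)).length :=
        mul_le_of_le_one_right (by positivity) hv.2
      linarith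
    have h4 := le_max_left ((A.sched (A.bid v)).length : ℝ) 1
    push_cast
    linarith

/-- Increment of a function bounded by the integral of its subgradient, with bisection error. -/
lemma sub_le_integral_bisect (u x : ℝ → ℝ)
    (hux : ∀ v ∈ Set.Icc (0 : ℝ) 1, ∀ w ∈ Set.Icc (0 : ℝ) 1, u v + x v * (w - v) ≤ u w)
    (hm : MonotoneOn x (Set.Icc 0 1)) (n : ℕ) :
    ∀ a b : ℝ, 0 ≤ a → a ≤ b → b ≤ 1 →
      u b - u a ≤ (∫ t in a..b, x t) + (x b - x a) * (b - a) / 2 ^ n := by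
  have hi : ∀ a b : ℝ, 0 ≤ a → a ≤ b → b ≤ 1 → IntervalIntegrable x volume a b := by
    intro a b ha hab hb
    apply MonotoneOn.intervalIntegrable
    rw [Set.uIcc_of_le hab]
    exact hm.mono (Set.Icc_subset_Icc ha hb)
  induction n with
  | zero =>
    intro a b ha hab hb
    have h1 := hux b ⟨by linarith, hb⟩ a ⟨ha, by linarith⟩
    have h2 : ∫ t in a..b, x a ≤ ∫ t in a..b, x t := by
      apply intervalIntegral.integral_mono_on hab (by simp) (hi a b ha hab hb)
      intro t ht
      exact hm ⟨ha, by linarith⟩ ⟨by linarith [ht.1], by linarith [ht.2]⟩ ht.1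
    rw [intervalIntegral.integral_const, smul_eq_mul] at h2
    simp only [pow_zero, div_one]
    nlinarith
  | succ n ih =>
    intro a b ha hab hb
    have h1 := ih a ((a + b) / 2) ha (by linarith) (by linarith)
    have h2 := ih ((a + b) / 2) b (by linarith) (by linarith) hb
    have h3 := intervalIntegral.integral_add_adjacent_intervals
      (hi a ((a + b) / 2) ha (by linarith) (by linarith))
      (hi ((a + b) / 2) b (by linarith) (by linarith) hb)
    rw [← h3]
    have e : (x b - x a) * (b - a) / 2 ^ (n + 1) =
        (x ((a + b) / 2) - x a) * ((a + b) / 2 - a) / 2 ^ n +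
        (x b - x ((a + b) / 2)) * (b - (a + b) / 2) / 2 ^ n := by
      rw [pow_succ]; field_simp; ring
    rw [e]; linarith

lemma sub_le_integral (u x : ℝ → ℝ)
    (hux : ∀ v ∈ Set.Icc (0 : ℝ) 1, ∀ w ∈ Set.Icc (0 : ℝ) 1, u v + x v * (w - v) ≤ u w)
    (hm : MonotoneOn x (Set.Icc 0 1)) :
    u 1 - u 0 ≤ ∫ t in (0 : ℝ)..1, x t := by
  have ht : Tendsto (fun n : ℕ => (∫ t in (0 : ℝ)..1, x t) +
      (x 1 - x 0) * (1 - 0) / (2 : ℝ) ^ n) atTop (nhds ((∫ t in (0 : ℝ)..1, x t) + 0)) := by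
    apply Tendsto.add tendsto_const_nhds
    apply Tendsto.div_atTop tendsto_const_nhds
    exact tendsto_pow_atTop_atTop_of_one_lt (by norm_num)
  rw [add_zero] at ht
  exact ge_of_tendsto' ht fun n =>
    sub_le_integral_bisect u x hux hm n 0 1 le_rfl zero_le_one le_rfl

lemma subgrad_bound (u x : ℝ → ℝ)
    (hux : ∀ v ∈ Set.Icc (0 : ℝ) 1, ∀ w ∈ Set.Icc (0 : ℝ) 1, u v + x v * (w - v) ≤ u w)
    (h0 : u 0 = 0) (hx : ∀ v ∈ Set.Icc (0 : ℝ) 1, 0 ≤ x v) :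
    Integrable u unif01 ∧ Integrable x unif01 ∧ MonotoneOn x (Set.Icc 0 1) ∧
      ∫ v, u v ∂unif01 ≤ (∫ v, x v ∂unif01) / 2 := by
  have hm : MonotoneOn x (Set.Icc 0 1) := by
    intro v hv w hw hvw
    rcases hvw.eq_or_lt with rfl | hlt
    · rfl
    have h1 := hux v hv w hw
    have h2 := hux w hw v hv
    nlinarith
  have hum : MonotoneOn u (Set.Icc 0 1) := by
    intro v hv w hw hvw
    have h1 := hux v hv w hw
    have := mul_nonneg (hx v hv) (sub_nonneg.mpr hvw)
    linarith
  have hui : Integrable u unif01 := hum.integrableOn_isCompact isCompact_Icc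
  have hxi : Integrable x unif01 := hm.integrableOn_isCompact isCompact_Icc
  refine ⟨hui, hxi, hm, ?_⟩
  have h1 := sub_le_integral u x hux hm
  rw [intervalIntegral.integral_of_le zero_le_one, ← integral_Icc_eq_integral_Ioc, h0,
    sub_zero] at h1
  refine integral_unif_le u (fun v => v * u 1) _ ?_ ?_ ?_ ?_
  · have : 0 ≤ ∫ v, x v ∂unif01 := setIntegral_nonneg measurableSet_Icc hx
    linarith
  · exact (Continuous.continuousOn (by fun_prop)).integrableOn_compact isCompact_Icc
  · have : ∫ v, v * u 1 ∂unif01 = u 1 / 2 := by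
      unfold unif01
      rw [integral_Icc_eq_integral_Ioc, ← intervalIntegral.integral_of_le zero_le_one,
        intervalIntegral.integral_mul_const, integral_id]
      ring
    rw [this]
    unfold unif01
    linarith
  · intro v hv
    have a1 := hux v hv 0 ⟨le_rfl, zero_le_one⟩
    have a2 := hux v hv 1 ⟨zero_le_one, le_rfl⟩
    rw [h0] at a1
    have b1 := mul_le_mul_of_nonneg_left a1 (sub_nonneg.mpr hv.2)
    have b2 := mul_le_mul_of_nonneg_left a2 hv.1
    nlinarith

lemma fixed_subgrad {n : ℕ} (A : SWAC n (Set.Icc (0 : ℝ) 1)) (hF : FixedRate A) :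
    ∀ v ∈ Set.Icc (0 : ℝ) 1, ∀ w ∈ Set.Icc (0 : ℝ) 1,
      util (A.sched (A.bid v)) v + ((A.sched (A.bid v)).length : ℝ) * (w - v) ≤
        util (A.sched (A.bid w)) w := by
  intro v hv w hw
  have e : util (A.sched (A.bid v)) v + ((A.sched (A.bid v)).length : ℝ) * (w - v) =
      util (A.sched (A.bid v)) w := by unfold util; ring
  rw [e]
  have hpos := util_nonneg _ _ (A.bid_IR w hw)
  have hB := A.bid_mem v hv
  by_cases hf : filt (A.sched (A.bid v)) ≤ w
  · exact A.bid_opt w hw _ hB hf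
  refine le_trans ?_ hpos
  obtain ⟨p, hp⟩ := hF _ hB
  generalize (A.sched (A.bid v)).length = m at hp
  rw [hp] at hf ⊢
  have hwp : w < p ∨ m = 0 := by
    by_contra hcon
    push Not at hcon
    apply hf
    rw [filt_le]
    refine ⟨hw.1, fun k hk => ?_⟩
    rw [List.length_replicate] at hk
    rw [List.take_replicate, List.sum_replicate, min_eq_left (by omega), nsmul_eq_mul]
    push_cast
    rw [mul_div_cancel_left₀ _ (by positivity)]
    exact hcon.1
  unfold util
  rw [List.length_replicate, List.sum_replicate, nsmul_eq_mul]
  rcases hwp with h | h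
  · have : (0 : ℝ) ≤ m := by positivity
    nlinarith
  · subst h; simp

lemma fixed_le (M : Mech (Set.Icc (0 : ℝ) 1) csg)
    (hF : ∀ (h : ℕ) (hist : List ℝ), FixedRate (M.au h hist)) (h : ℕ) : ∀ (hist : List ℝ),
    mechER (Set.Icc (0 : ℝ) 1) csg (fun _ => unif01) M h hist ≤ (h : ℝ) / 2 := by
  induction h using Nat.strong_induction_on with
  | _ h ih =>
    intro hist
    rcases h with _ | h
    · rw [mechER_zero_s19]; simp
    rw [mechER_succ]
    set A := M.au (h + 1) hist with hA
    set u : ℝ → ℝ := fun v => util (A.sched (A.bid v)) v with hu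
    set x : ℝ → ℝ := fun v => ((A.sched (A.bid v)).length : ℝ) with hx
    have h0mem : (0 : ℝ) ∈ Set.Icc (0 : ℝ) 1 := ⟨le_rfl, zero_le_one⟩
    have hu0 : u 0 = 0 := by
      apply le_antisymm
      · have : 0 ≤ (A.sched (A.bid 0)).sum :=
          List.sum_nonneg (A.pay_nonneg _ (A.bid_mem 0 h0mem))
        simp only [hu, util]; linarith
      · exact util_nonneg _ _ (A.bid_IR 0 h0mem)
    obtain ⟨hui, hxi, hm, hle⟩ := subgrad_bound u x (fixed_subgrad A (hF _ _)) hu0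
      (fun v _ => Nat.cast_nonneg _)
    refine integral_unif_le _ (fun v => u v + ((h + 1 : ℝ) - x v) / 2) _ (by positivity)
      (hui.add (((integrable_const _).sub hxi).div_const 2)) ?_ ?_
    · have hi2 : Integrable (fun v => ((h + 1 : ℝ) - x v) / 2) unif01 :=
        ((integrable_const _).sub hxi).div_const 2
      rw [integral_add hui hi2, integral_div,
        integral_sub (integrable_const _) hxi]
      simp only [integral_const, probReal_univ, smul_eq_mul]
      push_cast
      linarith
    · intro v hv
      have hB := A.bid_mem v hv
      have hlen := A.len_le _ hB
      have h1 := ih (h + 1 - max (A.sched (A.bid v)).length 1) (by omega) (hist ++ [A.bid v])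
      rw [cast_sub_max _ _ hlen] at h1
      have h4 := le_max_left ((A.sched (A.bid v)).length : ℝ) 1
      simp only [hu, hx]
      linarith

/-- Rent a single day for free. -/
noncomputable def freeSWAC (h : ℕ) : SWAC h (Set.Icc (0 : ℝ) 1) where
  B := {0}
  sched := fun _ => List.replicate (min h 1) 0
  bid := fun _ => 0
  len_le := by intro b _; simp
  pay_nonneg := by
    intro b _ p hp
    rw [List.eq_of_mem_replicate hp]
  bid_mem := by intro v _; simp
  bid_IR := by
    intro v hv
    rw [filt_le]
    refine ⟨hv.1, fun k hk => ?_⟩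
    simpa using hv.1
  bid_opt := by intro v _ b _ _; exact le_rfl

noncomputable def freeMech : Mech (Set.Icc (0 : ℝ) 1) csg where
  au := fun h _ => freeSWAC h
  mc := fun _ _ _ => 0
  tie := by
    intro h hist v _ b _ _ _
    exact le_rfl

lemma freeMech_fixed (h : ℕ) (hist : List ℝ) : FixedRate (freeMech.au h hist) := by
  intro b _
  refine ⟨0, ?_⟩
  simp [freeMech, freeSWAC]

lemma freeMech_ER (h : ℕ) : ∀ hist : List ℝ,
    mechER (Set.Icc (0 : ℝ) 1) csg (fun _ => unif01) freeMech h hist = (h : ℝ) / 2 := by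
  induction h with
  | zero => intro hist; rw [mechER_zero_s19]; simp
  | succ h ih =>
    intro hist
    rw [mechER_succ]
    have e : ∀ v : ℝ, util ((freeMech.au (h + 1) hist).sched
        ((freeMech.au (h + 1) hist).bid v)) v = v := by
      intro v; simp [freeMech, freeSWAC, util]
    have e2 : ∀ v : ℝ, ((freeMech.au (h + 1) hist).sched
        ((freeMech.au (h + 1) hist).bid v)).length = 1 := by
      intro v; simp [freeMech, freeSWAC]
    simp only [e, e2, max_self, Nat.add_sub_cancel, ih]
    have hid : Integrable (fun v : ℝ => v) unif01 :=
      continuous_id.continuousOn.integrableOn_compact isCompact_Icc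
    rw [integral_add hid (integrable_const _)]
    have : ∫ v, v ∂unif01 = 1 / 2 := by
      unfold unif01
      rw [integral_Icc_eq_integral_Ioc, ← intervalIntegral.integral_of_le zero_le_one,
        integral_id]
      norm_num
    rw [this]
    simp only [integral_const, probReal_univ, smul_eq_mul]
    push_cast; ring

lemma fixed_opt (n : ℕ) :
    sSup {x : ℝ | ∃ M : Mech (Set.Icc (0 : ℝ) 1) csg,
            (∀ (h : ℕ) (hist : List ℝ), FixedRate (M.au h hist)) ∧
            x = mechER (Set.Icc (0 : ℝ) 1) csg (fun _ => unif01) M n []} = (n : ℝ) / 2 := by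
  apply IsGreatest.csSup_eq
  refine ⟨⟨freeMech, freeMech_fixed, (freeMech_ER n []).symm⟩, ?_⟩
  rintro x ⟨M, hM, rfl⟩
  exact fixed_le M hM n []

/-- Schedule charging `q` on the first day and nothing afterwards. -/
noncomputable def frontSched (q : ℝ) (h : ℕ) : List ℝ :=
  match h with
  | 0 => []
  | k + 1 => q :: List.replicate k 0

lemma frontSched_length (q : ℝ) (h : ℕ) : (frontSched q h).length = h := by
  cases h <;> simp [frontSched]

lemma frontSched_filt_le (q : ℝ) (h : ℕ) (hq : 0 ≤ q) (v : ℝ) (hv : q ≤ v) :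
    filt (frontSched q h) ≤ v := by
  rw [filt_le]
  refine ⟨hq.trans hv, fun k hk => ?_⟩
  rw [frontSched_length] at hk
  cases h with
  | zero => omega
  | succ h =>
    simp only [frontSched, List.take_succ_cons, List.sum_cons, List.take_replicate,
      List.sum_replicate, smul_zero, add_zero]
    refine le_trans (div_le_self hq ?_) hv
    have : (0 : ℝ) ≤ k := by positivity
    linarith

lemma frontSched_filt_ge (q : ℝ) (h : ℕ) (v : ℝ) (hf : filt (frontSched q (h + 1)) ≤ v) :
    q ≤ v := by
  rw [filt_le] at hf
  have := hf.2 0 (by simp [frontSched])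
  simpa [frontSched] using this

lemma frontSched_util (q : ℝ) (h : ℕ) (v : ℝ) :
    util (frontSched q (h + 1)) v = (h + 1) * v - q := by
  simp [util, frontSched]

noncomputable def frontSWAC (q : ℝ) (hq : 0 ≤ q) (h : ℕ) : SWAC h (Set.Icc (0 : ℝ) 1) where
  B := Set.univ
  sched := fun b => if b = 1 then frontSched q h else []
  bid := fun v => if q ≤ v then 1 else 0
  len_le := by
    intro b _
    split_ifs
    · rw [frontSched_length]
    · simp
  pay_nonneg := by
    intro b _ p hp
    split_ifs at hp
    · cases h with
      | zero => simp [frontSched] at hp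
      | succ h =>
        rcases List.mem_cons.mp hp with rfl | hp
        · exact hq
        · rw [List.eq_of_mem_replicate hp]
    · simp at hp
  bid_mem := by intro v _; trivial
  bid_IR := by
    intro v hv
    by_cases h1 : q ≤ v
    · simpa [h1] using frontSched_filt_le q h hq v h1
    · simpa [h1, filt] using hv.1
  bid_opt := by
    intro v hv b _ hf
    by_cases h1 : q ≤ v
    · by_cases hb : b = 1
      · simp [h1, hb]
      · have := util_nonneg _ _ (frontSched_filt_le q h hq v h1)
        simpa [h1, hb, util] using this
    · by_cases hb : b = 1
      · rw [if_pos hb] at hf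
        cases h with
        | zero => simp [h1, hb, util, frontSched]
        | succ h => exact absurd (frontSched_filt_ge q h v hf) h1
      · simp [h1, hb]

noncomputable def frontMech (q : ℝ) (hq : 0 ≤ q) : Mech (Set.Icc (0 : ℝ) 1) csg where
  au := fun h _ => frontSWAC q hq h
  mc := fun _ _ _ => 0
  tie := by
    intro h hist v _ b _ _ heq
    simp only [SWAC.r, gross_csg, heq]
    exact le_rfl

lemma integral_step (q a b : ℝ) (hq : 0 ≤ q) (hq1 : q ≤ 1) :
    Integrable (fun v : ℝ => if q ≤ v then a else b) unif01 ∧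
    ∫ v, (if q ≤ v then a else b) ∂unif01 = (1 - q) * a + q * b := by
  have hi : Integrable (fun v : ℝ => if q ≤ v then a else b) unif01 :=
    Integrable.of_bound (C := max |a| |b|)
      ((measurable_const.ite measurableSet_Ici measurable_const).aestronglyMeasurable)
      (Eventually.of_forall fun v => by
        split_ifs <;> simp)
  refine ⟨hi, ?_⟩
  have e : (fun v : ℝ => if q ≤ v then a else b) =
      fun v => b + (Set.Ici q).indicator (fun _ => a - b) v := by
    funext v
    by_cases h : q ≤ v <;> simp [h]
  rw [e, integral_add (integrable_const _) ((integrable_const _).indicator measurableSet_Ici),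
    integral_indicator_const _ measurableSet_Ici]
  have hm : unif01.real (Set.Ici q) = 1 - q := by
    unfold unif01
    rw [measureReal_restrict_apply measurableSet_Ici]
    have : Set.Ici q ∩ Set.Icc (0 : ℝ) 1 = Set.Icc q 1 := by
      ext t; simp only [Set.mem_inter_iff, Set.mem_Ici, Set.mem_Icc]
      constructor
      · rintro ⟨h1, _, h3⟩; exact ⟨h1, h3⟩
      · rintro ⟨h1, h3⟩; exact ⟨h1, hq.trans h1, h3⟩
    rw [this, Real.volume_real_Icc_of_le hq1]
  rw [hm]
  simp only [integral_const, probReal_univ, smul_eq_mul]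
  ring

lemma frontMech_ER (q : ℝ) (hq : 0 ≤ q) (hq1 : q < 1) (h : ℕ) : ∀ hist : List ℝ,
    q * h - 1 / (1 - q) ≤
    mechER (Set.Icc (0 : ℝ) 1) csg (fun _ => unif01) (frontMech q hq) h hist := by
  have hpos : 0 < 1 - q := by linarith
  induction h with
  | zero =>
    intro hist; rw [mechER_zero_s19]
    have : 0 < 1 / (1 - q) := by positivity
    simp only [Nat.cast_zero]; linarith
  | succ h ih =>
    intro hist
    rw [mechER_succ]
    set b := mechER (Set.Icc (0 : ℝ) 1) csg (fun _ => unif01) (frontMech q hq) h (hist ++ [0])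
      with hb
    have e : ∀ v : ℝ, util (((frontMech q hq).au (h + 1) hist).sched
        (((frontMech q hq).au (h + 1) hist).bid v)) v +
        mechER (Set.Icc (0 : ℝ) 1) csg (fun _ => unif01) (frontMech q hq)
          ((h + 1) - max (((frontMech q hq).au (h + 1) hist).sched
            (((frontMech q hq).au (h + 1) hist).bid v)).length 1)
          (hist ++ [((frontMech q hq).au (h + 1) hist).bid v]) =
        if q ≤ v then (h + 1) * v - q else b := by
      intro v
      by_cases hv : q ≤ v
      · simp [frontMech, frontSWAC, hv, frontSched_util, frontSched_length, mechER_zero_s19]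
      · simp [frontMech, frontSWAC, hv, util, hb]
    simp only [e]
    obtain ⟨i1, i2⟩ := integral_step q ((h + 1) * q - q) b hq hq1.le
    have hi : Integrable (fun v : ℝ => if q ≤ v then (h + 1) * v - q else b) unif01 := by
      refine Integrable.of_bound (C := max ((h + 1) + q) |b|)
        ((Measurable.ite measurableSet_Ici (by fun_prop)
          measurable_const).aestronglyMeasurable) ?_
      refine (ae_restrict_iff' measurableSet_Icc).mpr (Eventually.of_forall fun v hv => ?_)
      split_ifs
      · refine le_trans ?_ (le_max_left _ _)
        rw [Real.norm_eq_abs, abs_le]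
        have : (0 : ℝ) ≤ h := by positivity
        constructor <;> nlinarith [hv.1, hv.2]
      · exact le_max_right _ _
    have hmono : ∫ v, (if q ≤ v then ((h : ℝ) + 1) * q - q else b) ∂unif01 ≤
        ∫ v, (if q ≤ v then ((h : ℝ) + 1) * v - q else b) ∂unif01 := by
      apply integral_mono i1 hi
      intro v
      dsimp only
      split_ifs with hv
      · have : (0 : ℝ) ≤ h := by positivity
        nlinarith
      · exact le_rfl
    refine le_trans ?_ hmono
    rw [i2]
    have hb1 := mul_le_mul_of_nonneg_left (ih (hist ++ [0])) hq
    rw [← hb] at hb1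
    have hC : (1 / (1 - q)) * (1 - q) = 1 := by field_simp
    push_cast
    nlinarith

lemma opt_bdd (n : ℕ) : BddAbove {x : ℝ | ∃ M : Mech (Set.Icc (0 : ℝ) 1) csg,
    x = mechER (Set.Icc (0 : ℝ) 1) csg (fun _ => unif01) M n []} := by
  refine ⟨(n : ℝ), ?_⟩
  rintro x ⟨M, rfl⟩
  exact mechER_le_s19 M n []

lemma opt_le (n : ℕ) : optRental (Set.Icc (0 : ℝ) 1) csg (fun _ => unif01) n ≤ n := by
  unfold optRental
  refine csSup_le ⟨_, freeMech, rfl⟩ ?_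
  rintro x ⟨M, rfl⟩
  exact mechER_le_s19 M n []

lemma opt_ge (q : ℝ) (hq : 0 ≤ q) (hq1 : q < 1) (n : ℕ) :
    q * n - 1 / (1 - q) ≤ optRental (Set.Icc (0 : ℝ) 1) csg (fun _ => unif01) n :=
  (frontMech_ER q hq hq1 n []).trans (le_csSup (opt_bdd n) ⟨_, rfl⟩)

lemma opt_tendsto : Tendsto (fun n : ℕ =>
        optRental (Set.Icc (0 : ℝ) 1) csg (fun _ => unif01) n / (n : ℝ))
      atTop (nhds 1) := by
  rw [tendsto_order]
  constructor
  · intro a ha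
    obtain ⟨q, hq, hq1⟩ := exists_between (max_lt ha (zero_lt_one : (0 : ℝ) < 1))
    have hq0 : 0 ≤ q := (le_max_right _ _).trans hq.le
    have haq : a < q := (le_max_left _ _).trans_lt hq
    have ht : Tendsto (fun n : ℕ => q - (1 / (1 - q)) / (n : ℝ)) atTop (nhds (q - 0)) :=
      tendsto_const_nhds.sub (tendsto_const_nhds.div_atTop tendsto_natCast_atTop_atTop)
    rw [sub_zero] at ht
    filter_upwards [ht.eventually_const_lt haq, eventually_gt_atTop 0] with n hn hn0
    refine hn.trans_le ?_
    have hn' : (0 : ℝ) < n := by exact_mod_cast hn0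
    rw [le_div_iff₀ hn', sub_mul, div_mul_cancel₀ _ hn'.ne']
    exact opt_ge q hq0 hq1 n
  · intro a ha
    filter_upwards [eventually_gt_atTop 0] with n hn0
    have hn' : (0 : ℝ) < n := by exact_mod_cast hn0
    refine lt_of_le_of_lt ?_ ha
    rw [div_le_one hn']
    exact opt_le n

/-- For the `n`-day rental game with i.i.d. uniform `[0,1]`
valuations and consumer surplus reward, the optimal expected reward `R_n`
satisfies `R_n / n → 1`; consequently, the ratio between the optimal expected
reward and the optimal expected reward among fixed-rate rental mechanisms tends
to `2`. -/
theorem uniform_consumer_surplus_ratio_tends_to_two :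
    Tendsto (fun n : ℕ =>
        optRental (Set.Icc (0 : ℝ) 1) csg (fun _ => unif01) n / (n : ℝ))
      atTop (nhds 1) ∧
    Tendsto (fun n : ℕ =>
        optRental (Set.Icc (0 : ℝ) 1) csg (fun _ => unif01) n /
          sSup {x : ℝ | ∃ M : Mech (Set.Icc (0 : ℝ) 1) csg,
            (∀ (h : ℕ) (hist : List ℝ), FixedRate (M.au h hist)) ∧
            x = mechER (Set.Icc (0 : ℝ) 1) csg (fun _ => unif01) M n []})
      atTop (nhds 2) := by
  refine ⟨opt_tendsto, ?_⟩
  simp only [fixed_opt]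
  have h := opt_tendsto.mul_const 2
  rw [one_mul] at h
  refine h.congr fun n => ?_
  rw [div_div_eq_mul_div, div_mul_eq_mul_div]

end RentalGame
end
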